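/- arXiv:2603.16135 — 2 statements merged into one kernel-verified Lean document; each statement's English description precedes it below -/
import Mathlib

section
/- There exists a universal numeric constant c > 0 satisfying the following: for every n ≥ 1, every orthotope Ω in ℝⁿ, and all integers k ≥ l ≥ 1, there exists a convex partition {Ω_i}_{i=1}^{l'} of Ω with l' ≤ l such that every part satisfies Diam Ω_i ≤ c · n^(3/2) · k / (l · √(μ_k(Ω))). -/
open MeasureTheory

/-- The `k`-th Neumann eigenvalue of the Laplacian on `Ω ⊆ ℝⁿ`, defined via the
Courant–Fischer min-max principle: the infimum over `(k+1)`-dimensional spaces `V`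
of test functions (smooth functions, distinguished by their restrictions to `Ω`)
of the supremum of the Rayleigh quotient `∫_Ω ‖∇f‖² / ∫_Ω f²` over nonzero `f ∈ V`. -/
noncomputable def neumannEigenvalue (n : ℕ) (k : ℕ)
    (Ω : Set (EuclideanSpace ℝ (Fin n))) : ℝ :=
  ⨅ V : {V : Submodule ℝ (EuclideanSpace ℝ (Fin n) → ℝ) //
      Module.finrank ℝ V = k + 1 ∧ (∀ f ∈ V, ContDiff ℝ (⊤ : ℕ∞) f) ∧
      ∀ f ∈ V, (∀ x ∈ Ω, f x = 0) → f = 0},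
    ⨆ f : {f : EuclideanSpace ℝ (Fin n) → ℝ // f ∈ V.1 ∧ f ≠ 0},
      (∫ x in Ω, ‖fderiv ℝ f.1 x‖ ^ 2) / ∫ x in Ω, (f.1 x) ^ 2

/-- `Ω` is an orthotope in `ℝⁿ`: up to a rigid motion, it is a product
`∏ i, [-a i, a i]` with all `a i > 0`. -/
def IsOrthotope (n : ℕ) (Ω : Set (EuclideanSpace ℝ (Fin n))) : Prop :=
  ∃ (T : EuclideanSpace ℝ (Fin n) ≃ᵢ EuclideanSpace ℝ (Fin n)) (a : Fin n → ℝ),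
    (∀ i, 0 < a i) ∧ Ω = T '' {x : EuclideanSpace ℝ (Fin n) | ∀ i, |x i| ≤ a i}

/-- `P` is a convex partition of `Ω`: finitely many convex pieces covering `Ω`
whose pairwise intersections have Lebesgue measure zero. -/
def IsConvexPartition {n m : ℕ} (Ω : Set (EuclideanSpace ℝ (Fin n)))
    (P : Fin m → Set (EuclideanSpace ℝ (Fin n))) : Prop :=
  (∀ i, Convex ℝ (P i)) ∧ Ω = ⋃ i, P i ∧
    ∀ i j, i ≠ j → MeasureTheory.volume (P i ∩ P j) = 0

open Set

/-- Cauchy–Schwarz on the unit interval. -/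
lemma sq_integral_le_aux (g : ℝ → ℝ) (hg : Continuous g) :
    (∫ t in (0:ℝ)..1, g t) ^ 2 ≤ ∫ t in (0:ℝ)..1, (g t) ^ 2 := by
  set m := ∫ t in (0:ℝ)..1, g t with hm
  have h0 : 0 ≤ ∫ t in (0:ℝ)..1, (g t - m) ^ 2 :=
    intervalIntegral.integral_nonneg (by norm_num) (fun t _ => sq_nonneg _)
  have h1 : ∫ t in (0:ℝ)..1, (g t - m) ^ 2 =
      (∫ t in (0:ℝ)..1, (g t) ^ 2) - m ^ 2 := by
    have e : ∀ t, (g t - m) ^ 2 = (g t) ^ 2 - 2 * m * g t + m ^ 2 := fun t => by ring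
    simp_rw [e]
    rw [intervalIntegral.integral_add, intervalIntegral.integral_sub,
      intervalIntegral.integral_const_mul, ← hm]
    · simp; ring
    all_goals exact Continuous.intervalIntegrable (by fun_prop) _ _
  linarith

lemma pointwise_aux {n : ℕ} (f : EuclideanSpace ℝ (Fin n) → ℝ) (hf : ContDiff ℝ (⊤ : ℕ∞) f)
    (x y : EuclideanSpace ℝ (Fin n)) (D : ℝ) (hD : ‖y - x‖ ≤ D) :
    (f y - f x) ^ 2 ≤ D ^ 2 * ∫ t in (0:ℝ)..1, ‖fderiv ℝ f (x + t • (y - x))‖ ^ 2 := by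
  have hc : Continuous (fderiv ℝ f) := hf.continuous_fderiv (by simp)
  have hd : Differentiable ℝ f := hf.differentiable (by simp)
  have h1 : ∫ t in (0:ℝ)..1, fderiv ℝ f (x + t • (y - x)) (y - x) = f y - f x := by
    have := intervalIntegral.integral_eq_sub_of_hasDerivAt (a := 0) (b := 1)
      (f := fun t : ℝ => f (x + t • (y - x)))
      (f' := fun t : ℝ => fderiv ℝ f (x + t • (y - x)) (y - x)) ?_ ?_
    · simpa using this
    · intro t _
      have h2 : HasDerivAt (fun t : ℝ => x + t • (y - x)) (y - x) t := by
        simpa using ((hasDerivAt_id t).smul_const (y - x)).const_add x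
      exact (hd _).hasFDerivAt.comp_hasDerivAt t h2
    · exact Continuous.intervalIntegrable (by fun_prop) _ _
  rw [← h1, ← intervalIntegral.integral_const_mul]
  refine (sq_integral_le_aux _ (by fun_prop)).trans ?_
  refine intervalIntegral.integral_mono_on (by norm_num)
    (Continuous.intervalIntegrable (by fun_prop) _ _)
    (Continuous.intervalIntegrable (by fun_prop) _ _) ?_
  intro t _
  have h3 := (fderiv ℝ f (x + t • (y - x))).le_opNorm (y - x)
  rw [← mul_pow, ← sq_abs]
  refine pow_le_pow_left₀ (abs_nonneg _) ?_ 2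
  rw [← Real.norm_eq_abs, mul_comm D]
  exact h3.trans (mul_le_mul_of_nonneg_left hD (norm_nonneg _))

lemma homothety_aux {n : ℕ} (Ω : Set (EuclideanSpace ℝ (Fin n))) (hc : Convex ℝ Ω)
    (hm : MeasurableSet Ω) (G : EuclideanSpace ℝ (Fin n) → ENNReal) (hG : Measurable G)
    (y : EuclideanSpace ℝ (Fin n)) (hy : y ∈ Ω) (s : ℝ) (hs : 1 / 2 ≤ s) (hs1 : s ≤ 1) :
    ∫⁻ x in Ω, G (s • x + (1 - s) • y) ≤ 2 ^ n * ∫⁻ x in Ω, G x := by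
  have hs0 : 0 < s := by linarith
  rw [← lintegral_indicator hm, ← lintegral_indicator hm]
  calc ∫⁻ x, Ω.indicator (fun x => G (s • x + (1 - s) • y)) x
      ≤ ∫⁻ x, Ω.indicator G (s • x + (1 - s) • y) := by
        refine lintegral_mono fun x => ?_
        by_cases hx : x ∈ Ω
        · have : s • x + (1 - s) • y ∈ Ω := hc hx hy hs0.le (by linarith) (by ring)
          simp [hx, this]
        · simp [hx]
    _ = ∫⁻ x, Ω.indicator G (x + (1 - s) • y) ∂(Measure.map (fun x => s • x) volume) := by
        rw [lintegral_map]
        · exact (hG.indicator hm).comp (by fun_prop)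
        · fun_prop
    _ = ENNReal.ofReal |(s ^ n)⁻¹| * ∫⁻ x, Ω.indicator G x := by
        rw [Measure.map_addHaar_smul _ hs0.ne', lintegral_smul_measure,
          lintegral_add_right_eq_self (fun x => Ω.indicator G x)]
        simp
    _ ≤ 2 ^ n * ∫⁻ x, Ω.indicator G x := by
        gcongr
        have : (2 : ENNReal) ^ n = ENNReal.ofReal (2 ^ n) := by
          rw [ENNReal.ofReal_pow (by norm_num)]; simp
        rw [this]
        refine ENNReal.ofReal_le_ofReal ?_
        rw [abs_of_pos (by positivity), ← inv_pow]
        refine pow_le_pow_left₀ (by positivity) ?_ n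
        rw [inv_le_comm₀ hs0 (by norm_num)]
        linarith

/-- Poincaré inequality on compact convex sets (crude constant). -/
lemma poincare_aux {n : ℕ} (Ω : Set (EuclideanSpace ℝ (Fin n))) (hc : Convex ℝ Ω)
    (hK : IsCompact Ω) (hpos : volume Ω ≠ 0)
    (f : EuclideanSpace ℝ (Fin n) → ℝ) (hf : ContDiff ℝ (⊤ : ℕ∞) f) (hmean : ∫ x in Ω, f x = 0) :
    ∫ x in Ω, (f x) ^ 2 ≤ (Metric.diam Ω) ^ 2 * 2 ^ n * ∫ x in Ω, ‖fderiv ℝ f x‖ ^ 2 := by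
  have hfc : Continuous f := hf.continuous
  have hdc : Continuous (fderiv ℝ f) := hf.continuous_fderiv (by simp)
  have hm : MeasurableSet Ω := hK.measurableSet
  have hfin : volume Ω ≠ ⊤ := hK.measure_lt_top.ne
  set D := Metric.diam Ω with hDdef
  set G : EuclideanSpace ℝ (Fin n) → ENNReal := fun z => ENNReal.ofReal (‖fderiv ℝ f z‖ ^ 2) with hGdef
  have hGm : Measurable G := by
    exact ENNReal.measurable_ofReal.comp (by apply Continuous.measurable; fun_prop)
  -- integrability of continuous functions
  have hint : ∀ g : EuclideanSpace ℝ (Fin n) → ℝ, Continuous g → IntegrableOn g Ω :=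
    fun g hg => hg.continuousOn.integrableOn_compact hK
  -- lower bound
  have hlow : volume Ω * ∫⁻ x in Ω, ENNReal.ofReal ((f x) ^ 2) ≤
      ∫⁻ x in Ω, ∫⁻ y in Ω, ENNReal.ofReal ((f y - f x) ^ 2) := by
    rw [← lintegral_const_mul' _ _ hfin]
    refine lintegral_mono fun x => ?_
    rw [← ofReal_integral_eq_lintegral_ofReal (hint _ (by fun_prop))
      (Filter.Eventually.of_forall fun y => sq_nonneg _)]
    have e : ∀ y, (f y - f x) ^ 2 = (f y) ^ 2 - 2 * f x * f y + (f x) ^ 2 := fun t => by ring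
    have : ∫ y in Ω, (f y - f x) ^ 2 = (∫ y in Ω, (f y) ^ 2) + volume.real Ω * (f x) ^ 2 := by
      simp_rw [e]
      rw [integral_add, integral_sub, integral_const_mul, hmean]
      · simp
      all_goals exact hint _ (by fun_prop)
    rw [this]
    have h2 : volume Ω = ENNReal.ofReal (volume.real Ω) := (ENNReal.ofReal_toReal hfin).symm
    rw [h2, ← ENNReal.ofReal_mul measureReal_nonneg]
    refine ENNReal.ofReal_le_ofReal ?_
    have : 0 ≤ ∫ y in Ω, (f y) ^ 2 := integral_nonneg fun y => sq_nonneg _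
    linarith
  -- upper bound
  have hup : ∫⁻ x in Ω, ∫⁻ y in Ω, ENNReal.ofReal ((f y - f x) ^ 2) ≤
      ENNReal.ofReal (D ^ 2) * (∫⁻ t in Ioc (0:ℝ) 1, ∫⁻ x in Ω, ∫⁻ y in Ω, G (x + t • (y - x))) := by
    have h1 : ∀ x ∈ Ω, ∀ y ∈ Ω, ENNReal.ofReal ((f y - f x) ^ 2) ≤
        ENNReal.ofReal (D ^ 2) * ∫⁻ t in Ioc (0:ℝ) 1, G (x + t • (y - x)) := by
      intro x hx y hy
      have hD : ‖y - x‖ ≤ D := by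
        rw [← dist_eq_norm]; exact Metric.dist_le_diam_of_mem hK.isBounded hy hx
      have h2 := pointwise_aux f hf x y D hD
      rw [intervalIntegral.integral_of_le (by norm_num)] at h2
      have hi : IntegrableOn (fun t : ℝ => ‖fderiv ℝ f (x + t • (y - x))‖ ^ 2) (Ioc 0 1) := by
        rw [← intervalIntegrable_iff_integrableOn_Ioc_of_le (by norm_num)]
        exact Continuous.intervalIntegrable (by fun_prop) _ _
      rw [← ofReal_integral_eq_lintegral_ofReal hi
        (Filter.Eventually.of_forall fun y => sq_nonneg _), ← ENNReal.ofReal_mul (sq_nonneg _)]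
      exact ENNReal.ofReal_le_ofReal h2
    calc ∫⁻ x in Ω, ∫⁻ y in Ω, ENNReal.ofReal ((f y - f x) ^ 2)
        ≤ ∫⁻ x in Ω, ∫⁻ y in Ω, ENNReal.ofReal (D ^ 2) *
            ∫⁻ t in Ioc (0:ℝ) 1, G (x + t • (y - x)) :=
          setLIntegral_mono' hm fun x hx => setLIntegral_mono' hm fun y hy => h1 x hx y hy
      _ = ENNReal.ofReal (D ^ 2) * ∫⁻ x in Ω, ∫⁻ y in Ω,
            ∫⁻ t in Ioc (0:ℝ) 1, G (x + t • (y - x)) := by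
          rw [← lintegral_const_mul' _ _ (by simp)]
          congr 1; ext x
          rw [← lintegral_const_mul' _ _ (by simp)]
      _ = _ := by
          congr 1
          have hin : ∀ x, ∫⁻ y in Ω, ∫⁻ t in Ioc (0:ℝ) 1, G (x + t • (y - x)) =
              ∫⁻ t in Ioc (0:ℝ) 1, ∫⁻ y in Ω, G (x + t • (y - x)) := by
            intro x
            rw [lintegral_lintegral_swap]
            refine (hGm.comp ?_).aemeasurable
            apply Continuous.measurable
            fun_prop
          simp_rw [hin]
          rw [lintegral_lintegral_swap]
          refine Measurable.aemeasurable ?_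
          refine Measurable.lintegral_prod_right' (f := fun p : (EuclideanSpace ℝ (Fin n) × ℝ) × EuclideanSpace ℝ (Fin n) => G (p.1.1 + p.1.2 • (p.2 - p.1.1))) ?_
          refine hGm.comp ?_
          apply Continuous.measurable
          fun_prop
  have hslice : ∀ t ∈ Ioc (0:ℝ) 1, ∫⁻ x in Ω, ∫⁻ y in Ω, G (x + t • (y - x)) ≤
      volume Ω * (2 ^ n * ∫⁻ x in Ω, G x) := by
    intro t ht
    rcases le_total t (1/2) with h | h
    · rw [lintegral_lintegral_swap]
      · calc _ ≤ ∫⁻ y in Ω, 2 ^ n * ∫⁻ x in Ω, G x := by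
              refine setLIntegral_mono' hm fun y hy => ?_
              refine le_trans (le_of_eq ?_) (homothety_aux Ω hc hm G hGm y hy (1 - t) (by linarith)
                (by linarith [ht.1]))
              congr 1; ext x; congr 1; module
          _ = _ := by simp [mul_comm]
      · refine (hGm.comp ?_).aemeasurable
        apply Continuous.measurable
        fun_prop
    · calc _ ≤ ∫⁻ y in Ω, 2 ^ n * ∫⁻ x in Ω, G x := by
              refine setLIntegral_mono' hm fun y hy => ?_
              refine le_trans (le_of_eq ?_) (homothety_aux Ω hc hm G hGm y hy t (by linarith)
                (by linarith [ht.2]))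
              congr 1; ext x; congr 1; module
          _ = _ := by simp [mul_comm]
  have hall : volume Ω * ∫⁻ x in Ω, ENNReal.ofReal ((f x) ^ 2) ≤
      volume Ω * (ENNReal.ofReal (D ^ 2) * (2 ^ n * ∫⁻ x in Ω, G x)) := by
    refine hlow.trans (hup.trans ?_)
    calc _ ≤ ENNReal.ofReal (D ^ 2) * ∫⁻ t in Ioc (0:ℝ) 1, volume Ω * (2 ^ n * ∫⁻ x in Ω, G x) := by
            refine mul_le_mul_right ?_ _
            exact setLIntegral_mono' measurableSet_Ioc hslice
      _ = _ := by
        simp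
        ring
  rw [ENNReal.mul_le_mul_iff_right hpos hfin] at hall
  rw [← ofReal_integral_eq_lintegral_ofReal (hint _ (by fun_prop))
      (Filter.Eventually.of_forall fun y => sq_nonneg _), hGdef,
    ← ofReal_integral_eq_lintegral_ofReal (hint _ (by fun_prop))
      (Filter.Eventually.of_forall fun y => sq_nonneg _)] at hall
  have h2 : (2 : ENNReal) ^ n = ENNReal.ofReal (2 ^ n) := by
    rw [ENNReal.ofReal_pow (by norm_num)]; simp
  have hnn : 0 ≤ ∫ x in Ω, ‖fderiv ℝ f x‖ ^ 2 := integral_nonneg fun y => sq_nonneg _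
  rw [h2, ← ENNReal.ofReal_mul (by positivity), ← ENNReal.ofReal_mul (by positivity),
    ENNReal.ofReal_le_ofReal_iff (by positivity)] at hall
  linarith

lemma toLp_norm_aux {n : ℕ} {F : Type*} [NormedAddCommGroup F]
    (μ : Measure (EuclideanSpace ℝ (Fin n))) (g : EuclideanSpace ℝ (Fin n) → F)
    (hg : MemLp g 2 μ) : ‖hg.toLp g‖ ^ 2 = ∫ x, ‖g x‖ ^ 2 ∂μ := by
  have hnn : 0 ≤ ∫ x, ‖g x‖ ^ 2 ∂μ := integral_nonneg fun y => sq_nonneg _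
  rw [Lp.norm_toLp, hg.eLpNorm_eq_integral_rpow_norm (by norm_num) (by norm_num)]
  simp only [ENNReal.toReal_ofNat, Real.rpow_ofNat]
  rw [ENNReal.toReal_ofReal (by positivity), ← Real.rpow_natCast, ← Real.rpow_mul hnn]
  norm_num

lemma ne_zero_integral_aux {n : ℕ} (Ω : Set (EuclideanSpace ℝ (Fin n))) (hc : Convex ℝ Ω)
    (hK : IsCompact Ω) (hint : (interior Ω).Nonempty)
    (f : EuclideanSpace ℝ (Fin n) → ℝ) (hf : Continuous f) (h0 : ∫ x in Ω, (f x) ^ 2 = 0) :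
    ∀ x ∈ Ω, f x = 0 := by
  have h1 : IntegrableOn (fun x => (f x) ^ 2) Ω :=
    (hf.pow 2).continuousOn.integrableOn_compact hK
  rw [integral_eq_zero_iff_of_nonneg (fun x => sq_nonneg _) h1] at h0
  have h2 : f =ᵐ[volume.restrict (interior Ω)] fun _ => (0:ℝ) := by
    have := ae_restrict_of_ae_restrict_of_subset interior_subset h0
    filter_upwards [this] with x hx
    simpa using hx
  have h3 := Measure.eqOn_open_of_ae_eq h2 isOpen_interior hf.continuousOn continuousOn_const
  have h4 : EqOn f (fun _ => (0:ℝ)) (closure (interior Ω)) :=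
    h3.closure hf continuous_const
  rw [hc.closure_interior_eq_closure_of_nonempty_interior hint] at h4
  exact fun x hx => h4 (subset_closure hx)

lemma bdd_aux {n : ℕ} (Ω : Set (EuclideanSpace ℝ (Fin n))) (hc : Convex ℝ Ω)
    (hK : IsCompact Ω) (hint : (interior Ω).Nonempty)
    (V : Submodule ℝ (EuclideanSpace ℝ (Fin n) → ℝ)) [FiniteDimensional ℝ V]
    (hV : ∀ f ∈ V, ContDiff ℝ (⊤ : ℕ∞) f) (hinj : ∀ f ∈ V, (∀ x ∈ Ω, f x = 0) → f = 0) :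
    ∃ C : ℝ, ∀ f ∈ V, ∫ x in Ω, ‖fderiv ℝ f x‖ ^ 2 ≤ C * ∫ x in Ω, (f x) ^ 2 := by
  have : IsFiniteMeasure (volume.restrict Ω) := ⟨by simpa using hK.measure_lt_top⟩
  have m1 : ∀ f ∈ V, MemLp f 2 (volume.restrict Ω) := fun f hf => by
    obtain ⟨C, hC⟩ := hK.exists_bound_of_continuousOn (hV f hf).continuous.continuousOn
    refine MemLp.of_bound (hV f hf).continuous.aestronglyMeasurable C ?_
    filter_upwards [ae_restrict_mem hK.measurableSet] with x hx using hC x hx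
  have m2 : ∀ f ∈ V, MemLp (fderiv ℝ f) 2 (volume.restrict Ω) := fun f hf => by
    have hdc : Continuous (fderiv ℝ f) := (hV f hf).continuous_fderiv (by simp)
    obtain ⟨C, hC⟩ := hK.exists_bound_of_continuousOn hdc.continuousOn
    refine MemLp.of_bound hdc.aestronglyMeasurable C ?_
    filter_upwards [ae_restrict_mem hK.measurableSet] with x hx using hC x hx
  let J : V →ₗ[ℝ] Lp ℝ 2 (volume.restrict Ω) :=
    { toFun := fun f => (m1 f.1 f.2).toLp f.1
      map_add' := fun f g => MemLp.toLp_add (m1 f.1 f.2) (m1 g.1 g.2)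
      map_smul' := fun c f => MemLp.toLp_const_smul c (m1 f.1 f.2) }
  have hdf : ∀ f ∈ V, Differentiable ℝ f := fun f hf => (hV f hf).differentiable (by simp)
  let D : V →ₗ[ℝ] Lp (EuclideanSpace ℝ (Fin n) →L[ℝ] ℝ) 2 (volume.restrict Ω) :=
    { toFun := fun f => (m2 f.1 f.2).toLp (fderiv ℝ f.1)
      map_add' := fun f g => by
        rw [← MemLp.toLp_add (m2 f.1 f.2) (m2 g.1 g.2)]
        congr 1
        ext1 x
        exact fderiv_add (hdf _ f.2 x) (hdf _ g.2 x)
      map_smul' := fun c f => by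
        rw [RingHom.id_apply, ← MemLp.toLp_const_smul c (m2 f.1 f.2)]
        congr 1
        ext1 x
        exact fderiv_const_smul (hdf _ f.2 x) c }
  have hJ : Function.Injective J := by
    rw [← LinearMap.ker_eq_bot, LinearMap.ker_eq_bot']
    intro f hf
    have h1 : ‖J f‖ ^ 2 = ∫ x in Ω, ‖f.1 x‖ ^ 2 := toLp_norm_aux _ _ (m1 f.1 f.2)
    rw [hf] at h1
    simp only [norm_zero, Real.norm_eq_abs, sq_abs] at h1
    have h2 := ne_zero_integral_aux Ω hc hK hint f.1 (hV _ f.2).continuous (by rw [← h1]; norm_num)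
    exact Subtype.ext (hinj _ f.2 h2)
  let e := LinearEquiv.ofInjective J hJ
  let A := LinearMap.toContinuousLinearMap (D ∘ₗ e.symm.toLinearMap)
  refine ⟨‖A‖ ^ 2, fun f hf => ?_⟩
  have h1 : ‖J ⟨f, hf⟩‖ ^ 2 = ∫ x in Ω, ‖f x‖ ^ 2 := toLp_norm_aux _ _ (m1 f hf)
  have h2 : ‖D ⟨f, hf⟩‖ ^ 2 = ∫ x in Ω, ‖fderiv ℝ f x‖ ^ 2 := toLp_norm_aux _ _ (m2 f hf)
  have h3 := A.le_opNorm (e ⟨f, hf⟩)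
  have h4 : A (e ⟨f, hf⟩) = D ⟨f, hf⟩ := by simp [A]
  have h5 : ‖e ⟨f, hf⟩‖ = ‖J ⟨f, hf⟩‖ := rfl
  rw [h4, h5] at h3
  simp only [Real.norm_eq_abs, sq_abs] at h1
  rw [← h1, ← h2, ← mul_pow]
  exact pow_le_pow_left₀ (norm_nonneg _) h3 2

/-- The Neumann eigenvalue is positive as soon as the space of test spaces is nonempty. -/
lemma eig_pos_aux {n k : ℕ} (hk : 1 ≤ k) (Ω : Set (EuclideanSpace ℝ (Fin n))) (hc : Convex ℝ Ω)
    (hK : IsCompact Ω) (hint : (interior Ω).Nonempty)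
    (hne : Nonempty {V : Submodule ℝ (EuclideanSpace ℝ (Fin n) → ℝ) //
      Module.finrank ℝ V = k + 1 ∧ (∀ f ∈ V, ContDiff ℝ (⊤ : ℕ∞) f) ∧
      ∀ f ∈ V, (∀ x ∈ Ω, f x = 0) → f = 0}) :
    0 < neumannEigenvalue n k Ω := by
  set C : ℝ := (Metric.diam Ω) ^ 2 * 2 ^ n + 1 with hC
  have hC0 : 0 < C := by positivity
  have hvol : volume Ω ≠ 0 :=
    (Measure.measure_pos_of_nonempty_interior _ hint).ne'
  refine lt_of_lt_of_le (inv_pos.mpr hC0) ?_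
  refine le_ciInf fun V => ?_
  obtain ⟨V, hdim, hsm, hinj⟩ := V
  have : FiniteDimensional ℝ V := Module.finite_of_finrank_pos (by omega)
  have hI : ∀ g : EuclideanSpace ℝ (Fin n) → ℝ, Continuous g → IntegrableOn g Ω :=
    fun g hg => hg.continuousOn.integrableOn_compact hK
  have hposf : ∀ f ∈ V, f ≠ 0 → 0 < ∫ x in Ω, (f x) ^ 2 := by
    intro f hf h0
    refine lt_of_le_of_ne (integral_nonneg fun y => sq_nonneg _) fun h => h0 ?_
    exact hinj f hf (ne_zero_integral_aux Ω hc hK hint f (hsm f hf).continuous h.symm)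
  let M : V →ₗ[ℝ] ℝ :=
    { toFun := fun f => ∫ x in Ω, f.1 x
      map_add' := fun f g => integral_add (hI _ (hsm _ f.2).continuous) (hI _ (hsm _ g.2).continuous)
      map_smul' := fun c f => integral_const_mul c _ }
  have hker : M.ker ≠ ⊥ := LinearMap.ker_ne_bot_of_finrank_lt (by rw [hdim]; simp; omega)
  obtain ⟨f, hf, hf0⟩ := (Submodule.ne_bot_iff _).1 hker
  have hmean : ∫ x in Ω, f.1 x = 0 := hf
  have hf0' : f.1 ≠ 0 := fun h => hf0 (Subtype.ext h)
  obtain ⟨B, hB⟩ := bdd_aux Ω hc hK hint V hsm hinj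
  refine le_ciSup_of_le (f := fun f : {f : EuclideanSpace ℝ (Fin n) → ℝ // f ∈ V ∧ f ≠ 0} => (∫ x in Ω, ‖fderiv ℝ f.1 x‖ ^ 2) / ∫ x in Ω, (f.1 x) ^ 2) ?_ ⟨f.1, f.2, hf0'⟩ ?_
  · refine ⟨B, ?_⟩
    rintro _ ⟨g, rfl⟩
    exact (div_le_iff₀ (hposf _ g.2.1 g.2.2)).2 (hB _ g.2.1)
  · have h1 := poincare_aux Ω hc hK hvol f.1 (hsm _ f.2) hmean
    have h2 := hposf _ f.2 hf0'
    have h3 : 0 ≤ ∫ x in Ω, ‖fderiv ℝ f.1 x‖ ^ 2 := integral_nonneg fun y => sq_nonneg _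
    show C⁻¹ ≤ (∫ x in Ω, ‖fderiv ℝ f.1 x‖ ^ 2) / ∫ x in Ω, (f.1 x) ^ 2
    rw [le_div_iff₀ h2, inv_mul_le_iff₀ hC0]
    linarith

/-- Upper bound for the Neumann eigenvalue through an explicit test space. -/
lemma eig_le_aux {n k : ℕ} (Ω : Set (EuclideanSpace ℝ (Fin n)))
    (φ : Fin (k + 1) → EuclideanSpace ℝ (Fin n) → ℝ) (hφ : ∀ j, ContDiff ℝ (⊤ : ℕ∞) (φ j))
    (lam : ℝ) (hlam : 0 ≤ lam)
    (h1 : ∀ c : Fin (k + 1) → ℝ, (∀ x ∈ Ω, ∑ j, c j * φ j x = 0) → c = 0)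
    (h2 : ∀ c : Fin (k + 1) → ℝ, ∫ x in Ω, ‖fderiv ℝ (fun y => ∑ j, c j * φ j y) x‖ ^ 2 ≤
      lam * ∫ x in Ω, (∑ j, c j * φ j x) ^ 2) :
    Nonempty {V : Submodule ℝ (EuclideanSpace ℝ (Fin n) → ℝ) //
      Module.finrank ℝ V = k + 1 ∧ (∀ f ∈ V, ContDiff ℝ (⊤ : ℕ∞) f) ∧
      ∀ f ∈ V, (∀ x ∈ Ω, f x = 0) → f = 0} ∧ neumannEigenvalue n k Ω ≤ lam := by
  have hrep : ∀ f ∈ Submodule.span ℝ (range φ), ∃ c : Fin (k + 1) → ℝ,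
      f = fun y => ∑ j, c j * φ j y := by
    intro f hf
    obtain ⟨c, hc⟩ := (Submodule.mem_span_range_iff_exists_fun ℝ).1 hf
    refine ⟨c, ?_⟩
    rw [← hc]
    ext y
    simp
  have hlin : LinearIndependent ℝ φ := by
    rw [Fintype.linearIndependent_iff]
    intro c hc j
    have := h1 c (fun x _ => by simpa using congrFun hc x)
    simp [this]
  let V : {V : Submodule ℝ (EuclideanSpace ℝ (Fin n) → ℝ) //
      Module.finrank ℝ V = k + 1 ∧ (∀ f ∈ V, ContDiff ℝ (⊤ : ℕ∞) f) ∧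
      ∀ f ∈ V, (∀ x ∈ Ω, f x = 0) → f = 0} := by
    refine ⟨Submodule.span ℝ (range φ), ?_, ?_, ?_⟩
    · rw [finrank_span_eq_card hlin]; simp
    · intro f hf
      obtain ⟨c, rfl⟩ := hrep f hf
      exact ContDiff.sum fun j _ => contDiff_const.mul (hφ j)
    · intro f hf h
      obtain ⟨c, rfl⟩ := hrep f hf
      have := h1 c h
      subst this
      ext; simp
  refine ⟨⟨V⟩, ?_⟩
  refine ciInf_le_of_le ?_ V ?_
  · refine ⟨0, ?_⟩
    rintro _ ⟨W, rfl⟩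
    refine Real.iSup_nonneg fun f => ?_
    exact div_nonneg (integral_nonneg fun y => sq_nonneg _) (integral_nonneg fun y => sq_nonneg _)
  · refine Real.iSup_le (fun f => ?_) hlam
    obtain ⟨f, hf, hf0⟩ := f
    obtain ⟨c, rfl⟩ := hrep f hf
    exact div_le_of_le_mul₀ (integral_nonneg fun y => sq_nonneg _) hlam (h2 c)

noncomputable def freqF (a : ℝ) (m : ℕ) : ℝ := Real.pi * m / (2 * a)

noncomputable def cosF (a : ℝ) (m : ℕ) (t : ℝ) : ℝ := Real.cos (freqF a m * (t + a))

noncomputable def sinF (a : ℝ) (m : ℕ) (t : ℝ) : ℝ := -(freqF a m * Real.sin (freqF a m * (t + a)))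

lemma hasDerivAt_cosF (a : ℝ) (m : ℕ) (t : ℝ) : HasDerivAt (cosF a m) (sinF a m t) t := by
  have h : HasDerivAt (fun t : ℝ => freqF a m * (t + a)) (freqF a m) t := by
    simpa using ((hasDerivAt_id t).add_const a).const_mul (freqF a m)
  have h2 := h.cos
  have e : sinF a m t = -Real.sin (freqF a m * (t + a)) * freqF a m := by
    unfold sinF; ring
  rw [e]
  exact h2

lemma hasDerivAt_sinF (a : ℝ) (m : ℕ) (t : ℝ) :
    HasDerivAt (sinF a m) (-(freqF a m ^ 2 * cosF a m t)) t := by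
  have h : HasDerivAt (fun t : ℝ => freqF a m * (t + a)) (freqF a m) t := by
    simpa using ((hasDerivAt_id t).add_const a).const_mul (freqF a m)
  have := (h.sin.const_mul (freqF a m)).neg
  have e : -(freqF a m ^ 2 * cosF a m t) =
      -(freqF a m * (Real.cos (freqF a m * (t + a)) * freqF a m)) := by
    unfold cosF; ring
  rw [e]
  exact this

lemma continuous_cosF (a : ℝ) (m : ℕ) : Continuous (cosF a m) := by
  unfold cosF; fun_prop

lemma continuous_sinF (a : ℝ) (m : ℕ) : Continuous (sinF a m) := by
  unfold sinF; fun_prop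

lemma sinF_left (a : ℝ) (m : ℕ) : sinF a m (-a) = 0 := by simp [sinF]

lemma sinF_right {a : ℝ} (ha : 0 < a) (m : ℕ) : sinF a m a = 0 := by
  have : freqF a m * (a + a) = m * Real.pi := by
    unfold freqF; field_simp; ring
  simp [sinF, this, Real.sin_nat_mul_pi]

lemma setIntegral_Icc_aux {a : ℝ} (ha : 0 < a) (g : ℝ → ℝ) :
    ∫ t in Icc (-a) a, g t = ∫ t in (-a)..a, g t := by
  rw [integral_Icc_eq_integral_Ioc, intervalIntegral.integral_of_le (by linarith)]

lemma sin_sin_aux {a : ℝ} (ha : 0 < a) (m p : ℕ) :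
    ∫ t in Icc (-a) a, sinF a m t * sinF a p t =
      freqF a p ^ 2 * ∫ t in Icc (-a) a, cosF a m t * cosF a p t := by
  rw [setIntegral_Icc_aux ha, setIntegral_Icc_aux ha]
  have h := intervalIntegral.integral_mul_deriv_eq_deriv_mul (a := -a) (b := a)
    (u := cosF a m) (v := sinF a p) (u' := sinF a m)
    (v' := fun t => -(freqF a p ^ 2 * cosF a p t))
    (fun x _ => hasDerivAt_cosF a m x) (fun x _ => hasDerivAt_sinF a p x)
    ((continuous_sinF a m).intervalIntegrable _ _)
    (Continuous.intervalIntegrable (by have := continuous_cosF a p; fun_prop) _ _)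
  rw [sinF_left, sinF_right ha] at h
  have e : ∀ t, cosF a m t * -(freqF a p ^ 2 * cosF a p t) =
    (-(freqF a p ^ 2)) * (cosF a m t * cosF a p t) := fun t => by ring
  simp_rw [e] at h
  rw [intervalIntegral.integral_const_mul] at h
  linarith

lemma cos_cos_aux {a : ℝ} (ha : 0 < a) {m p : ℕ} (hmp : m ≠ p) :
    ∫ t in Icc (-a) a, cosF a m t * cosF a p t = 0 := by
  have h1 := sin_sin_aux ha m p
  have h2 := sin_sin_aux ha p m
  simp_rw [mul_comm (sinF a p _) _, mul_comm (cosF a p _) _] at h2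
  rw [h1] at h2
  have h3 : freqF a p ^ 2 - freqF a m ^ 2 ≠ 0 := by
    intro h
    have h4 : freqF a p = freqF a m := by
      refine (pow_left_inj₀ ?_ ?_ two_ne_zero).1 (sub_eq_zero.1 h)
      all_goals unfold freqF; positivity
    unfold freqF at h4
    have hpi := Real.pi_pos
    field_simp at h4
    exact hmp (by exact_mod_cast h4.symm)
  have h5 : (freqF a p ^ 2 - freqF a m ^ 2) * ∫ t in Icc (-a) a, cosF a m t * cosF a p t = 0 := by
    linarith
  exact (mul_eq_zero.1 h5).resolve_left h3

lemma cos_pos_aux {a : ℝ} (ha : 0 < a) (m : ℕ) :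
    0 < ∫ t in Icc (-a) a, cosF a m t * cosF a m t := by
  rw [setIntegral_Icc_aux ha]
  have hc := continuous_cosF a m
  refine intervalIntegral.integral_pos (by linarith) (by fun_prop)
    (fun x _ => mul_self_nonneg _) ⟨-a, ⟨le_refl _, by linarith⟩, ?_⟩
  simp [cosF]

def boxF {n : ℕ} (a : Fin n → ℝ) : Set (EuclideanSpace ℝ (Fin n)) := {x | ∀ i, |x i| ≤ a i}

lemma integral_box_aux {n : ℕ} (a : Fin n → ℝ) (g : Fin n → ℝ → ℝ) :
    ∫ x in boxF a, ∏ i, g i (x i) = ∏ i, ∫ t in Icc (-a i) (a i), g i t := by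
  have h := (EuclideanSpace.volume_preserving_symm_measurableEquiv_toLp (Fin n)).setIntegral_preimage_emb
    (MeasurableEquiv.measurableEmbedding _) (fun y => ∏ i, g i (y i))
    (Set.univ.pi fun i => Icc (-a i) (a i))
  have e : boxF a = (MeasurableEquiv.toLp 2 (Fin n → ℝ)).symm ⁻¹' (Set.univ.pi fun i => Icc (-a i) (a i)) := by
    ext x
    simp only [boxF, abs_le, Set.mem_preimage, Set.mem_univ_pi, Set.mem_Icc]
    rfl
  rw [e]
  refine Eq.trans h ?_
  rw [volume_pi, Measure.restrict_pi_pi, integral_fintype_prod_eq_prod]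

noncomputable def phiF {n : ℕ} (a : Fin n → ℝ) (m : Fin n → ℕ) (x : EuclideanSpace ℝ (Fin n)) : ℝ :=
  ∏ i, cosF (a i) (m i) (x i)

noncomputable def dphiF {n : ℕ} (a : Fin n → ℝ) (j : Fin n) (m : Fin n → ℕ)
    (x : EuclideanSpace ℝ (Fin n)) : ℝ :=
  ∏ i, (if i = j then sinF (a i) (m i) (x i) else cosF (a i) (m i) (x i))

lemma phi_phi_aux {n : ℕ} (a : Fin n → ℝ) (m p : Fin n → ℕ) :
    ∫ x in boxF a, phiF a m x * phiF a p x =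
      ∏ i, ∫ t in Icc (-a i) (a i), cosF (a i) (m i) t * cosF (a i) (p i) t := by
  rw [← integral_box_aux a (fun i t => cosF (a i) (m i) t * cosF (a i) (p i) t)]
  simp_rw [phiF, Finset.prod_mul_distrib]

lemma phi_orth_aux {n : ℕ} {a : Fin n → ℝ} (ha : ∀ i, 0 < a i) {m p : Fin n → ℕ} (hmp : m ≠ p) :
    ∫ x in boxF a, phiF a m x * phiF a p x = 0 := by
  rw [phi_phi_aux]
  obtain ⟨i, hi⟩ := Function.ne_iff.1 hmp
  exact Finset.prod_eq_zero (Finset.mem_univ i) (cos_cos_aux (ha i) hi)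

lemma phi_pos_aux {n : ℕ} {a : Fin n → ℝ} (ha : ∀ i, 0 < a i) (m : Fin n → ℕ) :
    0 < ∫ x in boxF a, phiF a m x * phiF a m x := by
  rw [phi_phi_aux]
  exact Finset.prod_pos fun i _ => cos_pos_aux (ha i) _

lemma dphi_dphi_aux {n : ℕ} {a : Fin n → ℝ} (ha : ∀ i, 0 < a i) (j : Fin n) (m p : Fin n → ℕ) :
    ∫ x in boxF a, dphiF a j m x * dphiF a j p x =
      freqF (a j) (p j) ^ 2 * ∫ x in boxF a, phiF a m x * phiF a p x := by
  rw [phi_phi_aux]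
  have h := integral_box_aux a (fun i t => (if i = j then sinF (a i) (m i) t else cosF (a i) (m i) t) *
    (if i = j then sinF (a i) (p i) t else cosF (a i) (p i) t))
  simp_rw [dphiF, ← Finset.prod_mul_distrib]
  rw [h]
  rw [← Finset.mul_prod_erase _ _ (Finset.mem_univ j), ← Finset.mul_prod_erase Finset.univ
    (fun i => ∫ t in Icc (-a i) (a i), cosF (a i) (m i) t * cosF (a i) (p i) t) (Finset.mem_univ j)]
  simp only [if_true]
  rw [sin_sin_aux (ha j), mul_assoc]
  congr 2
  refine Finset.prod_congr rfl fun i hi => ?_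
  simp [Finset.ne_of_mem_erase hi]

lemma contDiff_phiF {n : ℕ} (a : Fin n → ℝ) (m : Fin n → ℕ) : ContDiff ℝ (⊤ : ℕ∞) (phiF a m) := by
  unfold phiF cosF
  fun_prop

lemma continuous_dphiF {n : ℕ} (a : Fin n → ℝ) (j : Fin n) (m : Fin n → ℕ) :
    Continuous (dphiF a j m) := by
  unfold dphiF
  refine continuous_finsetProd _ fun i _ => ?_
  split_ifs
  · exact (continuous_sinF _ _).comp (by fun_prop)
  · exact (continuous_cosF _ _).comp (by fun_prop)

lemma fderiv_phiF_apply {n : ℕ} (a : Fin n → ℝ) (m : Fin n → ℕ) (j : Fin n)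
    (x : EuclideanSpace ℝ (Fin n)) :
    fderiv ℝ (phiF a m) x (EuclideanSpace.single j 1) = dphiF a j m x := by
  have h1 : ∀ i ∈ (Finset.univ : Finset (Fin n)),
      HasFDerivAt (fun x : EuclideanSpace ℝ (Fin n) => cosF (a i) (m i) (x i))
        (sinF (a i) (m i) (x i) • (EuclideanSpace.proj i : EuclideanSpace ℝ (Fin n) →L[ℝ] ℝ)) x := by
    intro i _
    have hp : HasFDerivAt (fun x : EuclideanSpace ℝ (Fin n) => x i)
        (EuclideanSpace.proj i : EuclideanSpace ℝ (Fin n) →L[ℝ] ℝ) x :=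
      (EuclideanSpace.proj i : EuclideanSpace ℝ (Fin n) →L[ℝ] ℝ).hasFDerivAt
    exact HasDerivAt.comp_hasFDerivAt (h₂ := cosF (a i) (m i)) x
      (hasDerivAt_cosF (a i) (m i) (x i)) hp
  have h2 := HasFDerivAt.finsetProd h1
  have h3 : fderiv ℝ (phiF a m) x = _ := h2.fderiv
  rw [h3]
  simp only [_root_.sum_apply, _root_.smul_apply,
    smul_eq_mul]
  rw [Finset.sum_eq_single j]
  · unfold dphiF
    rw [← Finset.mul_prod_erase _ _ (Finset.mem_univ j)]
    simp only [if_true]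
    have e : ∀ i ∈ Finset.univ.erase j, (if i = j then sinF (a i) (m i) (x i) else
        cosF (a i) (m i) (x i)) = cosF (a i) (m i) (x i) := by
      intro i hi
      simp [Finset.ne_of_mem_erase hi]
    rw [Finset.prod_congr rfl e]
    simp [mul_comm]
  · intro i _ hij
    simp [hij]
  · simp

lemma opNorm_sq_le_aux {n : ℕ} (L : EuclideanSpace ℝ (Fin n) →L[ℝ] ℝ) :
    ‖L‖ ^ 2 ≤ ∑ j, (L (EuclideanSpace.single j 1)) ^ 2 := by
  have h : ‖L‖ ≤ Real.sqrt (∑ j, (L (EuclideanSpace.single j 1)) ^ 2) := by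
    refine L.opNorm_le_bound (Real.sqrt_nonneg _) fun x => ?_
    have hx : L x = ∑ j, L (EuclideanSpace.single j 1) * x j := by
      have e : x = ∑ j, x j • EuclideanSpace.single j (1:ℝ) := by
        ext i
        simp [Finset.sum_apply, Pi.single_apply]
      conv_lhs => rw [e]
      simp [mul_comm]
    rw [hx, EuclideanSpace.norm_eq, ← Real.sqrt_mul (by positivity), Real.norm_eq_abs]
    refine Real.abs_le_sqrt ?_
    simpa using Finset.sum_mul_sq_le_sq_mul_sq Finset.univ (fun j => L (EuclideanSpace.single j 1)) (fun j => x j)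
  calc ‖L‖ ^ 2 ≤ (Real.sqrt (∑ j, (L (EuclideanSpace.single j 1)) ^ 2)) ^ 2 :=
        pow_le_pow_left₀ (norm_nonneg _) h 2
    _ = _ := Real.sq_sqrt (by positivity)

lemma isCompact_boxF {n : ℕ} (a : Fin n → ℝ) : IsCompact (boxF a) := by
  have h : IsCompact (Set.univ.pi fun i => Icc (-a i) (a i)) := isCompact_univ_pi fun i => isCompact_Icc
  have e : boxF a = (EuclideanSpace.equiv (Fin n) ℝ).toHomeomorph ⁻¹' (Set.univ.pi fun i => Icc (-a i) (a i)) := by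
    ext x
    simp only [boxF, abs_le, Set.mem_preimage, Set.mem_univ_pi, Set.mem_Icc]
    rfl
  rw [e]
  exact (Homeomorph.isCompact_preimage _).2 h

lemma convex_boxF {n : ℕ} (a : Fin n → ℝ) : Convex ℝ (boxF a) := by
  intro x hx y hy s t hs ht hst i
  have h1 := abs_le.1 (hx i)
  have h2 := abs_le.1 (hy i)
  have : (s • x + t • y) i = s * x i + t * y i := by simp
  rw [this, abs_le]
  have e : a i = s * a i + t * a i := by rw [← add_mul, hst, one_mul]
  constructor <;> nlinarith

lemma interior_boxF {n : ℕ} {a : Fin n → ℝ} (ha : ∀ i, 0 < a i) : (interior (boxF a)).Nonempty := by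
  refine ⟨0, ?_⟩
  have ho : IsOpen {x : EuclideanSpace ℝ (Fin n) | ∀ i, |x i| < a i} := by
    simp only [ofPred_forall]
    exact isOpen_iInter_of_finite fun i => isOpen_lt (by fun_prop) continuous_const
  refine interior_maximal (s := boxF a) ?_ ho ?_
  · exact fun x hx i => (hx i).le
  · intro i
    simpa using ha i

section boxint
variable {n k : ℕ} (a : Fin n → ℝ) (M : Fin (k + 1) → Fin n → ℕ) (c : Fin (k + 1) → ℝ)

lemma quad_aux (ψ : Fin (k + 1) → EuclideanSpace ℝ (Fin n) → ℝ) (hψ : ∀ j, Continuous (ψ j)) :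
    ∫ x in boxF a, (∑ j, c j * ψ j x) ^ 2 =
      ∑ i, ∑ j, c i * c j * ∫ x in boxF a, ψ i x * ψ j x := by
  have hI : ∀ g : EuclideanSpace ℝ (Fin n) → ℝ, Continuous g → IntegrableOn g (boxF a) :=
    fun g hg => hg.continuousOn.integrableOn_compact (isCompact_boxF a)
  have e : ∀ x, (∑ j, c j * ψ j x) ^ 2 = ∑ i, ∑ j, c i * c j * (ψ i x * ψ j x) := by
    intro x
    rw [sq, Finset.sum_mul_sum]
    refine Finset.sum_congr rfl fun i _ => Finset.sum_congr rfl fun j _ => by ring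
  simp_rw [e]
  rw [integral_finsetSum]
  · refine Finset.sum_congr rfl fun i _ => ?_
    rw [integral_finsetSum]
    · refine Finset.sum_congr rfl fun j _ => ?_
      rw [integral_const_mul]
    · exact fun j _ => hI _ (by fun_prop)
  · exact fun j _ => hI _ (by fun_prop)

variable {a M}

lemma phi_sq_aux (ha : ∀ i, 0 < a i) (hM : Function.Injective M) : ∫ x in boxF a, (∑ j, c j * phiF a (M j) x) ^ 2 =
    ∑ j, c j ^ 2 * ∫ x in boxF a, phiF a (M j) x * phiF a (M j) x := by
  rw [quad_aux a c _ (fun j => (contDiff_phiF a (M j)).continuous)]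
  refine Finset.sum_congr rfl fun i _ => ?_
  rw [Finset.sum_eq_single i]
  · ring
  · intro j _ hji
    rw [phi_orth_aux ha (fun h => hji (hM h).symm)]
    simp
  · simp

lemma dphi_sq_aux (ha : ∀ i, 0 < a i) (hM : Function.Injective M) (p : Fin n) : ∫ x in boxF a, (∑ j, c j * dphiF a p (M j) x) ^ 2 =
    ∑ j, freqF (a p) (M j p) ^ 2 * (c j ^ 2 * ∫ x in boxF a, phiF a (M j) x * phiF a (M j) x) := by
  rw [quad_aux a c _ (fun j => continuous_dphiF a p (M j))]
  refine Finset.sum_congr rfl fun i _ => ?_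
  simp_rw [dphi_dphi_aux ha]
  rw [Finset.sum_eq_single i]
  · ring
  · intro j _ hji
    rw [phi_orth_aux ha (fun h => hji (hM h).symm)]
    simp
  · simp

lemma phi_indep_aux (ha : ∀ i, 0 < a i) (hM : Function.Injective M) (h : ∀ x ∈ boxF a, ∑ j, c j * phiF a (M j) x = 0) : c = 0 := by
  have h1 : ∫ x in boxF a, (∑ j, c j * phiF a (M j) x) ^ 2 = 0 := by
    rw [setIntegral_congr_fun (g := fun _ => (0:ℝ)) (isCompact_boxF a).measurableSet]
    · simp
    · intro x hx
      simp [h x hx]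
  rw [phi_sq_aux c ha hM, Finset.sum_eq_zero_iff_of_nonneg] at h1
  · ext j
    have := h1 j (Finset.mem_univ j)
    have h2 := phi_pos_aux ha (M j)
    simpa [h2.ne'] using this
  · intro j _
    have h2 := phi_pos_aux ha (M j)
    positivity

lemma phi_rayleigh_aux (ha : ∀ i, 0 < a i) (hM : Function.Injective M) (lam : ℝ) (hlam : ∀ j, ∑ p, freqF (a p) (M j p) ^ 2 ≤ lam) :
    ∫ x in boxF a, ‖fderiv ℝ (fun y => ∑ j, c j * phiF a (M j) y) x‖ ^ 2 ≤
      lam * ∫ x in boxF a, (∑ j, c j * phiF a (M j) x) ^ 2 := by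
  have hI : ∀ g : EuclideanSpace ℝ (Fin n) → ℝ, Continuous g → IntegrableOn g (boxF a) :=
    fun g hg => hg.continuousOn.integrableOn_compact (isCompact_boxF a)
  have hsm : ContDiff ℝ (⊤ : ℕ∞) (fun y => ∑ j, c j * phiF a (M j) y) :=
    ContDiff.sum fun j _ => contDiff_const.mul (contDiff_phiF a (M j))
  have hdc : Continuous (fderiv ℝ (fun y => ∑ j, c j * phiF a (M j) y)) :=
    hsm.continuous_fderiv (by simp)
  have hdphi := fun p j => continuous_dphiF a p (M j)
  have happ : ∀ x p, fderiv ℝ (fun y => ∑ j, c j * phiF a (M j) y) x (EuclideanSpace.single p 1) =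
      ∑ j, c j * dphiF a p (M j) x := by
    intro x p
    have hd : ∀ j, DifferentiableAt ℝ (phiF a (M j)) x :=
      fun j => ((contDiff_phiF a (M j)).differentiable (by simp)) x
    rw [fderiv_fun_sum (fun j _ => (hd j).const_mul _), _root_.sum_apply]
    refine Finset.sum_congr rfl fun j _ => ?_
    rw [fderiv_const_mul (hd j), _root_.smul_apply, fderiv_phiF_apply, smul_eq_mul]
  calc ∫ x in boxF a, ‖fderiv ℝ (fun y => ∑ j, c j * phiF a (M j) y) x‖ ^ 2
      ≤ ∫ x in boxF a, ∑ p, (∑ j, c j * dphiF a p (M j) x) ^ 2 := by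
        refine setIntegral_mono (hI _ (by fun_prop)) (hI _ (by fun_prop)) fun x => ?_
        refine (opNorm_sq_le_aux _).trans (le_of_eq ?_)
        simp_rw [happ]
    _ = ∑ p, ∑ j, freqF (a p) (M j p) ^ 2 *
          (c j ^ 2 * ∫ x in boxF a, phiF a (M j) x * phiF a (M j) x) := by
        rw [integral_finsetSum _ (fun p _ => hI _ (by fun_prop))]
        simp_rw [dphi_sq_aux c ha hM]
    _ = ∑ j, (∑ p, freqF (a p) (M j p) ^ 2) *
          (c j ^ 2 * ∫ x in boxF a, phiF a (M j) x * phiF a (M j) x) := by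
        rw [Finset.sum_comm]
        simp_rw [Finset.sum_mul]
    _ ≤ ∑ j, lam * (c j ^ 2 * ∫ x in boxF a, phiF a (M j) x * phiF a (M j) x) := by
        refine Finset.sum_le_sum fun j _ => mul_le_mul_of_nonneg_right (hlam j) ?_
        have h2 := phi_pos_aux ha (M j)
        positivity
    _ = _ := by rw [phi_sq_aux c ha hM, Finset.mul_sum]

end boxint

lemma iso_mp_aux {n : ℕ} (T : EuclideanSpace ℝ (Fin n) ≃ᵢ EuclideanSpace ℝ (Fin n)) :
    MeasurePreserving T (volume : Measure (EuclideanSpace ℝ (Fin n))) volume := by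
  have h := (measurePreserving_add_right (volume : Measure (EuclideanSpace ℝ (Fin n))) (T 0)).comp
    T.toRealLinearIsometryEquiv.measurePreserving
  have e : (fun x => x + T 0) ∘ T.toRealLinearIsometryEquiv = T := by
    ext1 x
    simp [IsometryEquiv.toRealLinearIsometryEquiv_apply]
  rwa [e] at h

lemma iso_hasFDerivAt_aux {n : ℕ} (T : EuclideanSpace ℝ (Fin n) ≃ᵢ EuclideanSpace ℝ (Fin n))
    (x : EuclideanSpace ℝ (Fin n)) :
    HasFDerivAt T (T.toRealLinearIsometryEquiv.toContinuousLinearEquiv :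
      EuclideanSpace ℝ (Fin n) →L[ℝ] EuclideanSpace ℝ (Fin n)) x := by
  have e : (fun x => T.toRealLinearIsometryEquiv x + T 0) = T := by
    ext1 x
    simp [IsometryEquiv.toRealLinearIsometryEquiv_apply]
  have h := (T.toRealLinearIsometryEquiv.toContinuousLinearEquiv.hasFDerivAt (x := x)).add_const (T 0)
  have e' : (fun x => T.toRealLinearIsometryEquiv.toContinuousLinearEquiv x + T 0) = T := e
  rwa [e'] at h

lemma iso_contDiff_aux {n : ℕ} (T : EuclideanSpace ℝ (Fin n) ≃ᵢ EuclideanSpace ℝ (Fin n)) :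
    ContDiff ℝ (⊤ : ℕ∞) T := by
  have e : (fun x => T.toRealLinearIsometryEquiv x + T 0) = T := by
    ext1 x
    simp [IsometryEquiv.toRealLinearIsometryEquiv_apply]
  rw [← e]
  exact T.toRealLinearIsometryEquiv.contDiff.add contDiff_const

lemma iso_norm_aux {n : ℕ} (T : EuclideanSpace ℝ (Fin n) ≃ᵢ EuclideanSpace ℝ (Fin n))
    (f : EuclideanSpace ℝ (Fin n) → ℝ) (hf : Differentiable ℝ f) (x : EuclideanSpace ℝ (Fin n)) :
    ‖fderiv ℝ (fun y => f (T y)) x‖ = ‖fderiv ℝ f (T x)‖ := by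
  have h := ((hf (T x)).hasFDerivAt.comp x (iso_hasFDerivAt_aux T x)).fderiv
  have e : (fun y => f (T y)) = f ∘ T := rfl
  rw [e, h]
  exact ContinuousLinearMap.opNorm_comp_linearIsometryEquiv _ _

lemma iso_convex_aux {n : ℕ} (T : EuclideanSpace ℝ (Fin n) ≃ᵢ EuclideanSpace ℝ (Fin n))
    {S : Set (EuclideanSpace ℝ (Fin n))} (hS : Convex ℝ S) : Convex ℝ (T '' S) := by
  have h := hS.affine_image T.toRealAffineIsometryEquiv.toAffineEquiv.toAffineMap
  have e : (T.toRealAffineIsometryEquiv.toAffineEquiv.toAffineMap :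
    EuclideanSpace ℝ (Fin n) → EuclideanSpace ℝ (Fin n)) = T := rfl
  rwa [e] at h

/-- Counting bound. -/
lemma count_aux {n k : ℕ} (T : EuclideanSpace ℝ (Fin n) ≃ᵢ EuclideanSpace ℝ (Fin n))
    {a : Fin n → ℝ} (ha : ∀ i, 0 < a i) {r : ℝ} (hr : 0 < r)
    (hcard : k + 1 ≤ ∏ i, (⌊2 * a i / r⌋₊ + 1)) :
    Nonempty {V : Submodule ℝ (EuclideanSpace ℝ (Fin n) → ℝ) //
      Module.finrank ℝ V = k + 1 ∧ (∀ f ∈ V, ContDiff ℝ (⊤ : ℕ∞) f) ∧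
      ∀ f ∈ V, (∀ x ∈ T '' boxF a, f x = 0) → f = 0} ∧
      neumannEigenvalue n k (T '' boxF a) ≤ n * (Real.pi / r) ^ 2 := by
  obtain ⟨M, hM, hMle⟩ : ∃ M : Fin (k + 1) → Fin n → ℕ, Function.Injective M ∧
      ∀ j i, M j i ≤ ⌊2 * a i / r⌋₊ := by
    obtain ⟨e⟩ := Function.Embedding.nonempty_of_card_le
      (α := Fin (k + 1)) (β := ∀ i, Fin (⌊2 * a i / r⌋₊ + 1)) (by simpa using hcard)
    refine ⟨fun j i => (e j i : ℕ), ?_, fun j i => Nat.lt_succ_iff.1 (e j i).2⟩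
    intro j j' h
    refine e.injective (funext fun i => Fin.ext (congrFun h i))
  have hlam : ∀ j, ∑ p, freqF (a p) (M j p) ^ 2 ≤ n * (Real.pi / r) ^ 2 := by
    intro j
    calc ∑ p, freqF (a p) (M j p) ^ 2 ≤ ∑ p : Fin n, (Real.pi / r) ^ 2 := by
          refine Finset.sum_le_sum fun p _ => ?_
          have hp := ha p
          have h1 : (M j p : ℝ) ≤ 2 * a p / r :=
            (Nat.cast_le.2 (hMle j p)).trans (Nat.floor_le (by positivity))
          have hpi := Real.pi_pos
          refine pow_le_pow_left₀ (by unfold freqF; positivity) ?_ 2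
          unfold freqF
          rw [div_le_div_iff₀ (by positivity) hr]
          rw [le_div_iff₀ hr] at h1
          nlinarith
      _ = _ := by simp
  have himg : ∀ g : EuclideanSpace ℝ (Fin n) → ℝ,
      ∫ x in T '' boxF a, g x = ∫ x in boxF a, g (T x) := fun g =>
    (iso_mp_aux T).setIntegral_image_emb (T.toHomeomorph.measurableEmbedding) g _
  refine eig_le_aux (T '' boxF a) (fun j x => phiF a (M j) (T.symm x))
    (fun j => (contDiff_phiF a (M j)).comp (iso_contDiff_aux T.symm)) _ (by positivity) ?_ ?_
  · intro c hc
    refine phi_indep_aux c ha hM fun x hx => ?_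
    have := hc (T x) ⟨x, hx, rfl⟩
    simpa using this
  · intro c
    rw [himg, himg]
    have hsm : ContDiff ℝ (⊤ : ℕ∞) (fun y => ∑ j, c j * phiF a (M j) y) :=
      ContDiff.sum fun j _ => contDiff_const.mul (contDiff_phiF a (M j))
    have h := fun x => iso_norm_aux T.symm _ (hsm.differentiable (by simp)) x
    simp_rw [h]
    simpa using phi_rayleigh_aux c ha hM _ hlam

/-- Elementary counting: rescaling the mesh. -/
lemma rescale_aux {n : ℕ} {x : Fin n → ℝ} (hx : ∀ i, 0 ≤ x i) {k l : ℕ} (hl : 1 ≤ l) (hlk : l ≤ k)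
    (h : ∏ i, (⌊x i⌋₊ + 1) ≤ k) :
    ∏ i, (⌊x i / (2 * (k / l : ℝ))⌋₊ + 1) ≤ l := by
  have hl0 : (0:ℝ) < l := by exact_mod_cast hl
  set t : ℝ := k / l with ht
  have ht1 : 1 ≤ t := by
    rw [ht, le_div_iff₀ hl0]; simpa using (by exact_mod_cast hlk : (l:ℝ) ≤ k)
  by_cases hall : ∀ i, ⌊x i / (2 * t)⌋₊ = 0
  · simp [hall, hl]
  · push Not at hall
    obtain ⟨i, hi⟩ := hall
    have h1 : 1 ≤ x i / (2 * t) := by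
      by_contra hlt
      exact hi (Nat.floor_eq_zero.2 (not_le.1 hlt))
    have hmono : ∀ j, ⌊x j / (2 * t)⌋₊ ≤ ⌊x j⌋₊ := fun j =>
      Nat.floor_mono (div_le_self (hx j) (by linarith))
    have h2 : ((⌊x i / (2 * t)⌋₊ + 1 : ℕ) : ℝ) * t ≤ ((⌊x i⌋₊ + 1 : ℕ) : ℝ) := by
      push_cast
      have h3 := Nat.floor_le (show 0 ≤ x i / (2 * t) by linarith)
      have h4 := Nat.lt_floor_add_one (x i)
      have h5 : x i / (2 * t) * (2 * t) = x i := by field_simp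
      nlinarith
    have h6 : ((∏ j, (⌊x j / (2 * t)⌋₊ + 1) : ℕ) : ℝ) * t ≤ k := by
      rw [← Finset.mul_prod_erase _ _ (Finset.mem_univ i)]
      calc _ = (((⌊x i / (2 * t)⌋₊ + 1 : ℕ) : ℝ) * t) *
            ((∏ j ∈ Finset.univ.erase i, (⌊x j / (2 * t)⌋₊ + 1) : ℕ) : ℝ) := by
            rw [Nat.cast_mul]; ring
        _ ≤ ((⌊x i⌋₊ + 1 : ℕ) : ℝ) * ((∏ j ∈ Finset.univ.erase i, (⌊x j⌋₊ + 1) : ℕ) : ℝ) := by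
            refine mul_le_mul h2 ?_ (by positivity) (by positivity)
            exact_mod_cast Finset.prod_le_prod' fun j _ => Nat.succ_le_succ (hmono j)
        _ ≤ k := by
            rw [← Nat.cast_mul, Finset.mul_prod_erase Finset.univ (fun j => ⌊x j⌋₊ + 1) (Finset.mem_univ i)]
            exact_mod_cast h
    have h7 : ((∏ j, (⌊x j / (2 * t)⌋₊ + 1) : ℕ) : ℝ) ≤ l := by
      have : (k : ℝ) = l * t := by rw [ht]; field_simp
      rw [this] at h6
      exact le_of_mul_le_mul_right h6 (by linarith)
    exact_mod_cast h7

def pieceF {n : ℕ} (a : Fin n → ℝ) (s : ℝ) (p : Fin n → ℕ) : Set (EuclideanSpace ℝ (Fin n)) :=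
  {x | x ∈ boxF a ∧ ∀ i, ⌊(x i + a i) / s⌋₊ = p i}

lemma piece_convex_aux {n : ℕ} (a : Fin n → ℝ) {s : ℝ} (hs : 0 < s) (p : Fin n → ℕ) :
    Convex ℝ (pieceF a s p) := by
  intro x hx y hy u v hu hv huv
  refine ⟨convex_boxF a hx.1 hy.1 hu hv huv, fun i => ?_⟩
  have e : ((u • x + v • y) i + a i) / s = u * ((x i + a i) / s) + v * ((y i + a i) / s) := by
    have : (u • x + v • y) i = u * x i + v * y i := by simp
    rw [this]
    have : a i = u * a i + v * a i := by rw [← add_mul, huv, one_mul]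
    field_simp
    linarith
  have h0 : ∀ z ∈ boxF a, 0 ≤ (z i + a i) / s := fun z hz =>
    div_nonneg (by linarith [(abs_le.1 (hz i)).1]) hs.le
  have hx1 := (Nat.floor_eq_iff (h0 x hx.1)).1 (hx.2 i)
  have hy1 := (Nat.floor_eq_iff (h0 y hy.1)).1 (hy.2 i)
  have hm := convex_Ico (p i : ℝ) ((p i : ℝ) + 1) hx1 hy1 hu hv huv
  simp only [smul_eq_mul] at hm
  rw [e]
  refine (Nat.floor_eq_iff ?_).2 hm
  exact (Nat.cast_nonneg _).trans hm.1

lemma piece_diam_aux {n : ℕ} (a : Fin n → ℝ) {s : ℝ} (hs : 0 < s) (p : Fin n → ℕ) :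
    Metric.diam (pieceF a s p) ≤ Real.sqrt n * s := by
  refine Metric.diam_le_of_forall_dist_le (by positivity) fun x hx y hy => ?_
  have h0 : ∀ i, ∀ z ∈ boxF a, 0 ≤ (z i + a i) / s := fun i z hz =>
    div_nonneg (by linarith [(abs_le.1 (hz i)).1]) hs.le
  have hc : ∀ i, dist (x i) (y i) ^ 2 ≤ s ^ 2 := by
    intro i
    have hx1 := (Nat.floor_eq_iff (h0 i x hx.1)).1 (hx.2 i)
    have hy1 := (Nat.floor_eq_iff (h0 i y hy.1)).1 (hy.2 i)
    rw [le_div_iff₀ hs, div_lt_iff₀ hs] at hx1 hy1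
    rw [Real.dist_eq]
    refine pow_le_pow_left₀ (abs_nonneg _) ?_ 2
    rw [abs_le]
    constructor <;> nlinarith [hx1.1, hx1.2, hy1.1, hy1.2]
  rw [EuclideanSpace.dist_eq]
  calc Real.sqrt (∑ i, dist (x i) (y i) ^ 2) ≤ Real.sqrt (n * s ^ 2) := by
        refine Real.sqrt_le_sqrt ?_
        calc _ ≤ ∑ i : Fin n, s ^ 2 := Finset.sum_le_sum fun i _ => hc i
          _ = _ := by simp
    _ = _ := by rw [Real.sqrt_mul (by positivity), Real.sqrt_sq hs.le]

/-- Partition lemma: there is a universal constant `c > 0` such that for every `n ≥ 1`,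
every orthotope `Ω ⊆ ℝⁿ`, and all integers `k ≥ l ≥ 1`, there is a convex partition of
`Ω` into `l' ≤ l` pieces, each of diameter at most `c · n^(3/2) · k / (l·√(μ_k(Ω)))`. -/
theorem partition_lemma_one :
    ∃ c : ℝ, 0 < c ∧ ∀ n : ℕ, 1 ≤ n →
      ∀ Ω : Set (EuclideanSpace ℝ (Fin n)), IsOrthotope n Ω →
        ∀ k l : ℕ, 1 ≤ l → l ≤ k →
          ∃ (l' : ℕ) (P : Fin l' → Set (EuclideanSpace ℝ (Fin n))),
            l' ≤ l ∧ IsConvexPartition Ω P ∧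
            ∀ i, Metric.diam (P i) ≤
              c * (n : ℝ) ^ ((3 : ℝ) / 2) * (k : ℝ) /
                ((l : ℝ) * Real.sqrt (neumannEigenvalue n k Ω)) := by
  refine ⟨4 * Real.pi, by positivity, ?_⟩
  rintro n hn Ω ⟨T, a, ha, rfl⟩ k l hl hlk
  change ∃ (l' : ℕ) (P : Fin l' → Set (EuclideanSpace ℝ (Fin n))),
            l' ≤ l ∧ IsConvexPartition (T '' boxF a) P ∧
            ∀ i, Metric.diam (P i) ≤
              4 * Real.pi * (n : ℝ) ^ ((3 : ℝ) / 2) * (k : ℝ) /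
                ((l : ℝ) * Real.sqrt (neumannEigenvalue n k (T '' boxF a)))
  have hpi := Real.pi_pos
  have hn0 : (1:ℝ) ≤ n := by exact_mod_cast hn
  have hl0 : (0:ℝ) < l := by exact_mod_cast hl
  have hk0 : (0:ℝ) < k := by exact_mod_cast (lt_of_lt_of_le hl hlk)
  -- positivity of the eigenvalue
  have hpos : 0 < neumannEigenvalue n k (T '' boxF a) := by
    refine eig_pos_aux (hl.trans hlk) _ (iso_convex_aux T (convex_boxF a))
      ((isCompact_boxF a).image T.continuous) ?_ ?_
    · have := T.toHomeomorph.image_interior (boxF a)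
      have e : T.toHomeomorph '' boxF a = T '' boxF a := rfl
      rw [← e, ← this]
      exact (interior_boxF ha).image _
    · let i0 : Fin n := ⟨0, hn⟩
      have hi0 := ha i0
      have hr : 0 < 2 * a i0 / k := by positivity
      refine (count_aux (k := k) T ha hr ?_).1
      have h1 : k + 1 ≤ ⌊2 * a i0 / (2 * a i0 / k)⌋₊ + 1 := by
        have : 2 * a i0 / (2 * a i0 / k) = k := by field_simp
        rw [this, Nat.floor_natCast]
      refine h1.trans ?_
      exact Finset.single_le_prod' (f := fun i => ⌊2 * a i / (2 * a i0 / k)⌋₊ + 1)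
        (fun i _ => Nat.le_add_left 1 _) (Finset.mem_univ i0)
  set μ := neumannEigenvalue n k (T '' boxF a) with hμ
  have hsq : 0 < Real.sqrt μ := Real.sqrt_pos.2 hpos
  have hsn : 0 < Real.sqrt n := Real.sqrt_pos.2 (by linarith)
  set r : ℝ := 2 * Real.pi * Real.sqrt n / Real.sqrt μ with hr
  have hr0 : 0 < r := by positivity
  have hcount : ∏ i, (⌊2 * a i / r⌋₊ + 1) ≤ k := by
    by_contra hlt
    have h1 := (count_aux (k := k) T ha hr0 (by omega)).2
    have h2 : (n : ℝ) * (Real.pi / r) ^ 2 = μ / 4 := by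
      rw [hr]
      have e1 := Real.sq_sqrt hpos.le
      have e2 := Real.sq_sqrt (show (0:ℝ) ≤ n by linarith)
      field_simp
      rw [e1, e2]
      ring
    rw [h2] at h1
    linarith
  set s : ℝ := r * (2 * (k / l : ℝ)) with hs
  have hs0 : 0 < s := by positivity
  have hcard : ∏ i, (⌊2 * a i / s⌋₊ + 1) ≤ l := by
    have := rescale_aux (x := fun i => 2 * a i / r)
      (fun i => by have := ha i; positivity) hl hlk hcount
    simp_rw [div_div] at this
    simpa [hs, div_div] using this
  let I := ∀ i : Fin n, Fin (⌊2 * a i / s⌋₊ + 1)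
  let e := (Fintype.equivFin I).symm
  refine ⟨Fintype.card I, fun q => T '' pieceF a s (fun i => (e q i : ℕ)), ?_, ⟨?_, ?_, ?_⟩, ?_⟩
  · simpa [I] using hcard
  · exact fun q => iso_convex_aux T (piece_convex_aux a hs0 _)
  · rw [← image_iUnion]
    congr 1
    ext x
    simp only [mem_iUnion]
    constructor
    · intro hx
      have hlt : ∀ i, ⌊(x i + a i) / s⌋₊ < ⌊2 * a i / s⌋₊ + 1 := by
        intro i
        refine Nat.lt_succ_of_le (Nat.floor_mono ?_)
        have := (abs_le.1 (hx i)).2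
        gcongr
        linarith
      refine ⟨e.symm fun i => ⟨_, hlt i⟩, hx, fun i => ?_⟩
      simp
    · rintro ⟨q, hq⟩
      exact hq.1
  · intro p q hpq
    rw [← image_inter T.injective]
    have : pieceF a s (fun i => (e p i : ℕ)) ∩ pieceF a s (fun i => (e q i : ℕ)) = ∅ := by
      rw [eq_empty_iff_forall_notMem]
      rintro x ⟨h1, h2⟩
      refine hpq (e.injective (funext fun i => Fin.ext ?_))
      exact (h1.2 i).symm.trans (h2.2 i)
    rw [this]
    simp
  · intro q
    rw [T.isometry.diam_image]
    refine (piece_diam_aux a hs0 _).trans ?_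
    have h1 : Real.sqrt n * s = 4 * Real.pi * n * k / (l * Real.sqrt μ) := by
      rw [hs, hr]
      have e2 := Real.sq_sqrt (show (0:ℝ) ≤ n by linarith)
      field_simp
      rw [e2]
      ring
    rw [h1]
    have h2 : (n : ℝ) ≤ (n : ℝ) ^ ((3 : ℝ) / 2) := by
      conv_lhs => rw [← Real.rpow_one (n : ℝ)]
      exact Real.rpow_le_rpow_of_exponent_le hn0 (by norm_num)
    gcongr
end

section
/- There exists a universal constant c > 0 (one may take c = 92²) such that for every n ≥ 1, any two bounded convex domains Ω ⊆ Ω' in ℝⁿ, and every k ≥ 0, the Neumann eigenvalues of the Laplacian satisfy μ_k(Ω') ≤ c · n² · μ_k(Ω). -/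
open MeasureTheory

open MeasureTheory

namespace PLpart
open Set ENNReal

lemma amgm (x y : ℝ≥0∞) : 4 * (x * y) ≤ (x + y) ^ 2 := by
  wlog h : x ≤ y generalizing x y
  · rw [mul_comm x, add_comm]; exact this y x (le_of_not_ge h)
  obtain ⟨d, rfl⟩ := exists_add_of_le h
  have : (x + (x + d)) ^ 2 = 4 * (x * (x + d)) + d ^ 2 := by ring
  rw [this]; exact le_self_add

/-- One-dimensional Brunn-Minkowski, midpoint form. -/
lemma bm1 {A B C : Set ℝ} (hA : MeasurableSet A) (hB : MeasurableSet B)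
    (hAn : A.Nonempty) (hBn : B.Nonempty)
    (h : ∀ x ∈ A, ∀ y ∈ B, (x + y) / 2 ∈ C) :
    volume A + volume B ≤ 2 * volume C := by
  -- compact case
  have key : ∀ K L : Set ℝ, IsCompact K → IsCompact L → K.Nonempty → L.Nonempty → K ⊆ A → L ⊆ B →
      volume K + volume L ≤ 2 * volume C := by
    intro K L hK hL hKn hLn hKA hLB
    obtain ⟨a, haK, ha⟩ := hK.exists_isGreatest hKn
    obtain ⟨b, hbL, hb⟩ := hL.exists_isLeast hLn
    have hvol : ∀ (c : ℝ) (S : Set ℝ), volume ((fun x => (1/2 : ℝ) * x) ⁻¹' ((fun x => c / 2 + x) ⁻¹' S)) = 2 * volume S := by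
      intro c S
      rw [Real.volume_preimage_mul_left (by norm_num), measure_preimage_add]
      congr 1
      norm_num
    have hC1 : (fun x : ℝ => (x + b) / 2) '' K ⊆ C := by
      rintro _ ⟨x, hx, rfl⟩; exact h x (hKA hx) b (hLB hbL)
    have hC2 : (fun x : ℝ => (a + x) / 2) '' L ⊆ C := by
      rintro _ ⟨x, hx, rfl⟩; exact h a (hKA haK) x (hLB hx)
    have e1 : volume K = 2 * volume ((fun x : ℝ => (x + b) / 2) '' K) := by
      rw [← hvol b]; congr 1; ext x
      simp only [mem_preimage, mem_image]
      constructor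
      · intro hx; exact ⟨x, hx, by ring⟩
      · rintro ⟨y, hy, hxy⟩
        have : y = x := by linarith
        rwa [← this]
    have e2 : volume L = 2 * volume ((fun x : ℝ => (a + x) / 2) '' L) := by
      rw [← hvol a]; congr 1; ext x
      simp only [mem_preimage, mem_image]
      constructor
      · intro hx; exact ⟨x, hx, by ring⟩
      · rintro ⟨y, hy, hxy⟩
        have : y = x := by linarith
        rwa [← this]
    have hm : MeasurableSet ((fun x : ℝ => (a + x) / 2) '' L) :=
      (hL.image (by fun_prop)).measurableSet
    rw [e1, e2, ← mul_add]
    gcongr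
    rw [← measure_union_add_inter _ hm]
    have hi : volume ((fun x : ℝ => (x + b) / 2) '' K ∩ (fun x : ℝ => (a + x) / 2) '' L) = 0 := by
      refine measure_mono_null (t := {(a + b) / 2}) ?_ (by simp)
      rintro _ ⟨⟨x, hx, rfl⟩, ⟨y, hy, hxy⟩⟩
      have h1 := ha hx
      have h2 := hb hy
      simp only [mem_singleton_iff]
      simp only at hxy
      linarith
    rw [hi, add_zero]
    exact measure_mono (union_subset hC1 hC2)
  obtain ⟨x0, hx0⟩ := hAn
  obtain ⟨y0, hy0⟩ := hBn
  rw [hA.measure_eq_iSup_isCompact, hB.measure_eq_iSup_isCompact]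
  simp_rw [iSup_and']
  refine ENNReal.biSup_add_biSup_le' ⟨∅, by simp⟩ ⟨∅, by simp⟩ ?_
  rintro K ⟨hKA, hK⟩ L ⟨hLB, hL⟩
  refine le_trans (add_le_add (measure_mono (subset_insert x0 K))
    (measure_mono (subset_insert y0 L))) ?_
  exact key _ _ (hK.insert x0) (hL.insert y0) (insert_nonempty _ _) (insert_nonempty _ _)
    (insert_subset hx0 hKA) (insert_subset hy0 hLB)

lemma pl1_norm {f g h : ℝ → ℝ} (hf : Measurable f) (hg : Measurable g) (hh : Measurable h)
    (hf0 : ∀ x, 0 ≤ f x) (hg0 : ∀ x, 0 ≤ g x) (hh0 : ∀ x, 0 ≤ h x)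
    (hf1 : ∀ x, f x ≤ 1) (hg1 : ∀ x, g x ≤ 1)
    (hfs : ∀ t < 1, ∃ x, t < f x) (hgs : ∀ t < 1, ∃ x, t < g x)
    (H : ∀ x y t, t < f x → t < g y → t < h ((x + y) / 2)) :
    (∫⁻ x, ENNReal.ofReal (f x)) + (∫⁻ x, ENNReal.ofReal (g x))
      ≤ 2 * ∫⁻ x, ENNReal.ofReal (h x) := by
  rw [lintegral_eq_lintegral_meas_lt _ (.of_forall hf0) hf.aemeasurable,
    lintegral_eq_lintegral_meas_lt _ (.of_forall hg0) hg.aemeasurable,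
    lintegral_eq_lintegral_meas_lt _ (.of_forall hh0) hh.aemeasurable]
  have mf : Measurable (fun t : ℝ => volume {a : ℝ | t < f a}) :=
    Antitone.measurable fun s t hst => measure_mono fun a (ha : t < f a) => lt_of_le_of_lt hst ha
  rw [← lintegral_add_left mf, ← lintegral_const_mul' _ _ (by simp)]
  refine lintegral_mono fun t => ?_
  by_cases ht : t < 1
  · exact bm1 (measurableSet_lt measurable_const hf) (measurableSet_lt measurable_const hg)
      (hfs t ht) (hgs t ht) fun x hx y hy => H x y t hx hy
  · have e1 : {a | t < f a} = ∅ := by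
      ext a; simp only [mem_ofPred_eq, mem_empty_iff_false, iff_false, not_lt]
      exact (hf1 a).trans (not_lt.1 ht)
    have e2 : {a | t < g a} = ∅ := by
      ext a; simp only [mem_ofPred_eq, mem_empty_iff_false, iff_false, not_lt]
      exact (hg1 a).trans (not_lt.1 ht)
    simp [e1, e2]

lemma pl1_bdd {f g h : ℝ → ℝ≥0∞} (hf : Measurable f) (hg : Measurable g) (hh : Measurable h)
    (N : ℝ≥0∞) (hN : N ≠ ∞) (hfN : ∀ x, f x ≤ N) (hgN : ∀ x, g x ≤ N)
    (H : ∀ x y, f x * g y ≤ h ((x + y) / 2) ^ 2) :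
    (∫⁻ x, f x) * (∫⁻ x, g x) ≤ (∫⁻ x, h x) ^ 2 := by
  set a := ⨆ x, f x with ha
  set b := ⨆ x, g x with hb
  have haN : a ≤ N := iSup_le hfN
  have hbN : b ≤ N := iSup_le hgN
  have hat : a ≠ ∞ := ne_top_of_le_ne_top hN haN
  have hbt : b ≠ ∞ := ne_top_of_le_ne_top hN hbN
  have hfa : ∀ x, f x ≤ a := le_iSup f
  have hgb : ∀ x, g x ≤ b := le_iSup g
  by_cases ha0 : a = 0
  · have : ∀ x, f x = 0 := fun x => le_antisymm (ha0 ▸ hfa x) bot_le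
    simp [this]
  by_cases hb0 : b = 0
  · have : ∀ x, g x = 0 := fun x => le_antisymm (hb0 ▸ hgb x) bot_le
    simp [this]
  set c : ℝ := Real.sqrt (a.toReal * b.toReal) with hc
  have hap : 0 < a.toReal := ENNReal.toReal_pos ha0 hat
  have hbp : 0 < b.toReal := ENNReal.toReal_pos hb0 hbt
  have hcp : 0 < c := Real.sqrt_pos.2 (by positivity)
  have hc2 : c ^ 2 = a.toReal * b.toReal := Real.sq_sqrt (by positivity)
  have hcE : ENNReal.ofReal c ^ 2 = a * b := by
    rw [← ENNReal.ofReal_pow hcp.le, hc2, ENNReal.ofReal_mul hap.le, ENNReal.ofReal_toReal hat,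
      ENNReal.ofReal_toReal hbt]
  have hft : ∀ x, f x ≠ ∞ := fun x => ne_top_of_le_ne_top hat (hfa x)
  have hgt : ∀ x, g x ≠ ∞ := fun x => ne_top_of_le_ne_top hbt (hgb x)
  let f1 : ℝ → ℝ := fun x => (f x).toReal / a.toReal
  let g1 : ℝ → ℝ := fun x => (g x).toReal / b.toReal
  let h1 : ℝ → ℝ := fun x => (min (h x) (ENNReal.ofReal c)).toReal / c
  have hf1le : ∀ x, f1 x ≤ 1 := fun x => by
    simp only [f1]; rw [div_le_one hap]; exact ENNReal.toReal_mono hat (hfa x)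
  have hg1le : ∀ x, g1 x ≤ 1 := fun x => by
    simp only [g1]; rw [div_le_one hbp]; exact ENNReal.toReal_mono hbt (hgb x)
  have hfs : ∀ t < 1, ∃ x, t < f1 x := by
    intro t ht
    rcases lt_or_ge t 0 with ht0 | ht0
    · exact ⟨0, ht0.trans_le (by simp only [f1]; positivity)⟩
    have : ENNReal.ofReal (t * a.toReal) < a := by
      rw [ENNReal.ofReal_lt_iff_lt_toReal (by positivity) hat]; nlinarith
    obtain ⟨x, hx⟩ := lt_iSup_iff.1 this
    refine ⟨x, ?_⟩
    simp only [f1]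
    rw [lt_div_iff₀ hap]
    exact (ENNReal.ofReal_lt_iff_lt_toReal (by positivity) (hft x)).1 hx
  have hgs : ∀ t < 1, ∃ x, t < g1 x := by
    intro t ht
    rcases lt_or_ge t 0 with ht0 | ht0
    · exact ⟨0, ht0.trans_le (by simp only [g1]; positivity)⟩
    have : ENNReal.ofReal (t * b.toReal) < b := by
      rw [ENNReal.ofReal_lt_iff_lt_toReal (by positivity) hbt]; nlinarith
    obtain ⟨x, hx⟩ := lt_iSup_iff.1 this
    refine ⟨x, ?_⟩
    simp only [g1]
    rw [lt_div_iff₀ hbp]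
    exact (ENNReal.ofReal_lt_iff_lt_toReal (by positivity) (hgt x)).1 hx
  have h1nn : ∀ x, 0 ≤ h1 x := fun x => by simp only [h1]; positivity
  have key := pl1_norm (f := f1) (g := g1) (h := h1)
    (hf.ennreal_toReal.div_const _) (hg.ennreal_toReal.div_const _)
    ((hh.min measurable_const).ennreal_toReal.div_const _)
    (fun x => by simp only [f1]; positivity) (fun x => by simp only [g1]; positivity) h1nn
    hf1le hg1le hfs hgs ?_
  · have ef : ∫⁻ x, f x = a * ∫⁻ x, ENNReal.ofReal (f1 x) := by
      rw [← lintegral_const_mul' _ _ hat]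
      congr 1; ext x
      simp only [f1]
      rw [ENNReal.ofReal_div_of_pos hap, ENNReal.ofReal_toReal hat, ENNReal.ofReal_toReal (hft x),
        ENNReal.mul_div_cancel ha0 hat]
    have eg : ∫⁻ x, g x = b * ∫⁻ x, ENNReal.ofReal (g1 x) := by
      rw [← lintegral_const_mul' _ _ hbt]
      congr 1; ext x
      simp only [g1]
      rw [ENNReal.ofReal_div_of_pos hbp, ENNReal.ofReal_toReal hbt, ENNReal.ofReal_toReal (hgt x),
        ENNReal.mul_div_cancel hb0 hbt]
    have eh : ENNReal.ofReal c * ∫⁻ x, ENNReal.ofReal (h1 x) ≤ ∫⁻ x, h x := by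
      rw [← lintegral_const_mul' _ _ (by simp)]
      refine lintegral_mono fun x => ?_
      simp only [h1]
      rw [ENNReal.ofReal_div_of_pos hcp, ENNReal.ofReal_toReal
        (ne_top_of_le_ne_top ENNReal.ofReal_ne_top (min_le_right _ _)),
        ENNReal.mul_div_cancel (by simpa using hcp) (by simp)]
      exact min_le_left _ _
    set F := ∫⁻ x, ENNReal.ofReal (f1 x)
    set G := ∫⁻ x, ENNReal.ofReal (g1 x)
    set K := ∫⁻ x, ENNReal.ofReal (h1 x)
    have h4 : 4 * (F * G) ≤ 4 * K ^ 2 := by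
      calc 4 * (F * G) ≤ (F + G) ^ 2 := amgm F G
        _ ≤ (2 * K) ^ 2 := by gcongr
        _ = 4 * K ^ 2 := by ring
    have h5 : F * G ≤ K ^ 2 := (ENNReal.mul_le_mul_iff_right (by simp) (by simp)).1 h4
    calc (∫⁻ x, f x) * ∫⁻ x, g x = (a * b) * (F * G) := by rw [ef, eg]; ring
      _ ≤ (a * b) * K ^ 2 := by gcongr
      _ = (ENNReal.ofReal c * K) ^ 2 := by rw [← hcE]; ring
      _ ≤ _ := by gcongr
  · intro x y t hx hy
    rcases lt_or_ge t 0 with ht | ht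
    · exact ht.trans_le (h1nn _)
    simp only [h1]
    rw [lt_div_iff₀ hcp]
    rcases le_total (ENNReal.ofReal c) (h ((x + y) / 2)) with hle | hle
    · rw [min_eq_right hle, ENNReal.toReal_ofReal hcp.le]
      have := hf1le x
      nlinarith
    · rw [min_eq_left hle]
      have hht : h ((x + y) / 2) ≠ ∞ := ne_top_of_le_ne_top ENNReal.ofReal_ne_top hle
      have hH := ENNReal.toReal_mono (by finiteness) (H x y)
      rw [ENNReal.toReal_mul, ENNReal.toReal_pow] at hH
      simp only [f1, g1] at hx hy
      rw [lt_div_iff₀ hap] at hx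
      rw [lt_div_iff₀ hbp] at hy
      refine lt_of_pow_lt_pow_left₀ 2 ENNReal.toReal_nonneg (lt_of_lt_of_le ?_ hH)
      rw [mul_pow, hc2]
      calc t ^ 2 * (a.toReal * b.toReal) = (t * a.toReal) * (t * b.toReal) := by ring
        _ < _ := mul_lt_mul'' hx hy (by positivity) (by positivity)

/-- The Prekopa-Leindler property (midpoint version). -/
def PL {E : Type*} [AddCommGroup E] [Module ℝ E] [MeasurableSpace E] (μ : Measure E) : Prop :=
  ∀ f g h : E → ℝ≥0∞, Measurable f → Measurable g → Measurable h →
    (∀ x y, f x * g y ≤ h ((1/2 : ℝ) • (x + y)) ^ 2) →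
    (∫⁻ x, f x ∂μ) * (∫⁻ x, g x ∂μ) ≤ (∫⁻ x, h x ∂μ) ^ 2

lemma PL_real : PL (volume : Measure ℝ) := by
  intro f g h hf hg hh H
  have tr : ∀ f : ℝ → ℝ≥0∞, Measurable f →
      Filter.Tendsto (fun n : ℕ => ∫⁻ x, min (f x) n) Filter.atTop (nhds (∫⁻ x, f x)) := by
    intro f hf
    refine lintegral_tendsto_of_tendsto_of_monotone
      (fun n => (hf.min measurable_const).aemeasurable) (.of_forall ?_) (.of_forall ?_)
    · intro x m n hmn
      simp only
      gcongr
    · intro x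
      have := (tendsto_const_nhds (x := f x)).min ENNReal.tendsto_nat_nhds_top
      simpa using this
  rcases eq_or_ne (∫⁻ x, h x) ∞ with hi | hi
  · simp [hi]
  have key : ∀ n : ℕ, (∫⁻ x, min (f x) n) * (∫⁻ x, min (g x) n) ≤ (∫⁻ x, h x) ^ 2 := by
    intro n
    refine pl1_bdd (hf.min measurable_const) (hg.min measurable_const) hh n (by simp)
      (fun x => min_le_right _ _) (fun x => min_le_right _ _) fun x y => ?_
    calc min (f x) n * min (g y) n ≤ f x * g y := by gcongr <;> exact min_le_left _ _
      _ ≤ _ := H x y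
      _ = _ := by congr 2; simp; ring
  -- take limits one at a time to avoid `0 * ∞`
  have mono : ∀ (f : ℝ → ℝ≥0∞), Monotone fun n : ℕ => ∫⁻ x, min (f x) n := by
    intro f m n hmn
    refine lintegral_mono fun x => ?_
    simp only
    gcongr
  have ef : ∫⁻ x, f x = ⨆ n : ℕ, ∫⁻ x, min (f x) n :=
    tendsto_nhds_unique (tr f hf) (tendsto_atTop_iSup (mono f))
  have eg : ∫⁻ x, g x = ⨆ n : ℕ, ∫⁻ x, min (g x) n :=
    tendsto_nhds_unique (tr g hg) (tendsto_atTop_iSup (mono g))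
  rw [ef, eg, ENNReal.iSup_mul]
  refine iSup_le fun m => ?_
  rw [ENNReal.mul_iSup]
  refine iSup_le fun n => ?_
  refine le_trans ?_ (key (max m n))
  exact mul_le_mul' (mono f (le_max_left m n)) (mono g (le_max_right m n))

lemma PL_prod {E F : Type*} [AddCommGroup E] [Module ℝ E] [MeasurableSpace E]
    [AddCommGroup F] [Module ℝ F] [MeasurableSpace F] {μ : Measure E} {ν : Measure F}
    [SFinite μ] [SFinite ν] (hμ : PL μ) (hν : PL ν) : PL (μ.prod ν) := by
  intro f g h hf hg hh H
  rw [lintegral_prod _ hf.aemeasurable, lintegral_prod _ hg.aemeasurable,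
    lintegral_prod _ hh.aemeasurable]
  refine hμ _ _ _ hf.lintegral_prod_right' hg.lintegral_prod_right' hh.lintegral_prod_right' ?_
  intro x y
  refine hν _ _ _ (hf.comp measurable_prodMk_left) (hg.comp measurable_prodMk_left)
    (hh.comp measurable_prodMk_left) ?_
  intro u v
  exact H (x, u) (y, v)

lemma PL_map {E F : Type*} [AddCommGroup E] [Module ℝ E] [MeasurableSpace E]
    [AddCommGroup F] [Module ℝ F] [MeasurableSpace F] {μ : Measure E} {ν : Measure F}
    (e : E → F) (he : MeasurePreserving e μ ν)
    (hlin : ∀ x y, e ((1/2 : ℝ) • (x + y)) = (1/2 : ℝ) • (e x + e y)) (hμ : PL μ) : PL ν := by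
  intro f g h hf hg hh H
  rw [← he.lintegral_comp hf, ← he.lintegral_comp hg, ← he.lintegral_comp hh]
  refine hμ _ _ _ (hf.comp he.measurable) (hg.comp he.measurable) (hh.comp he.measurable) ?_
  intro x y
  have := H (e x) (e y)
  rw [← hlin] at this
  exact this

lemma PL_pi (n : ℕ) : PL (volume : Measure (Fin n → ℝ)) := by
  induction n with
  | zero =>
    intro f g h hf hg hh H
    have e : ∀ f : (Fin 0 → ℝ) → ℝ≥0∞, ∫⁻ x, f x = f 0 := by
      intro f
      rw [Measure.volume_pi_eq_dirac 0, lintegral_dirac]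
    rw [e, e, e]
    convert H 0 0 using 3
  | succ n ih =>
    refine PL_map (MeasurableEquiv.piFinSuccAbove (fun _ : Fin (n + 1) => ℝ) 0).symm
      (volume_preserving_piFinSuccAbove (fun _ : Fin (n + 1) => ℝ) 0).symm ?_
      (PL_prod PL_real ih)
    intro x y
    ext i
    refine Fin.cases ?_ (fun j => ?_) i <;> simp [MeasurableEquiv.piFinSuccAbove, mul_add]

lemma PL_euclidean (n : ℕ) : PL (volume : Measure (EuclideanSpace ℝ (Fin n))) :=
  PL_map (MeasurableEquiv.toLp 2 (Fin n → ℝ))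
    (EuclideanSpace.volume_preserving_symm_measurableEquiv_toLp (Fin n)).symm
    (fun _ _ => rfl) (PL_pi n)

end PLpart

namespace Poinc
open Set

abbrev EE (n : ℕ) := EuclideanSpace ℝ (Fin n)

lemma integrableOn_of_cont {n : ℕ} {S : Set (EE n)} (hS : Bornology.IsBounded S)
    {F : Type*} [NormedAddCommGroup F] {u : EE n → F} (hu : Continuous u) :
    IntegrableOn u S := by
  have : IsCompact (closure S) := hS.isCompact_closure
  exact (hu.continuousOn.integrableOn_compact this).mono_set subset_closure

lemma real_PL {n : ℕ} {S : Set (EE n)} (hS : Bornology.IsBounded S) (hm : MeasurableSet S)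
    (hc : Convex ℝ S) {u v w : EE n → ℝ} (hu : Continuous u) (hv : Continuous v)
    (hw : Continuous w) (u0 : ∀ x, 0 ≤ u x) (v0 : ∀ x, 0 ≤ v x) (w0 : ∀ x, 0 ≤ w x)
    (H : ∀ x ∈ S, ∀ y ∈ S, u x * v y ≤ w ((1/2 : ℝ) • (x + y)) ^ 2) :
    (∫ x in S, u x) * (∫ x in S, v x) ≤ (∫ x in S, w x) ^ 2 := by
  have e : ∀ u : EE n → ℝ, Continuous u → (∀ x, 0 ≤ u x) →
      ENNReal.ofReal (∫ x in S, u x) = ∫⁻ x, S.indicator (fun x => ENNReal.ofReal (u x)) x := by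
    intro u hu u0
    rw [ofReal_integral_eq_lintegral_ofReal (integrableOn_of_cont hS hu) (.of_forall u0),
      lintegral_indicator hm]
  have m : ∀ u : EE n → ℝ, Continuous u →
      Measurable (S.indicator (fun x => ENNReal.ofReal (u x))) := fun u hu =>
    (hu.measurable.ennreal_ofReal).indicator hm
  have key := PLpart.PL_euclidean n _ _ _ (m u hu) (m v hv) (m w hw) ?_
  · rw [← e u hu u0, ← e v hv v0, ← e w hw w0,
      ← ENNReal.ofReal_mul (integral_nonneg u0), ← ENNReal.ofReal_pow (integral_nonneg w0)] at key
    exact (ENNReal.ofReal_le_ofReal_iff (by positivity)).1 key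
  · intro x y
    by_cases hx : x ∈ S
    · by_cases hy : y ∈ S
      · have hxy : (1/2 : ℝ) • (x + y) ∈ S := by
          rw [smul_add]
          exact hc hx hy (by norm_num) (by norm_num) (by norm_num)
        rw [indicator_of_mem hx, indicator_of_mem hy, indicator_of_mem hxy,
          ← ENNReal.ofReal_mul (u0 _), ← ENNReal.ofReal_pow (w0 _)]
        exact ENNReal.ofReal_le_ofReal (H x hx y hy)
      · simp [hy]
    · simp [hx]

lemma taylor {n : ℕ} {S : Set (EE n)} (hS : Bornology.IsBounded S)
    {f : EE n → ℝ} (hf : ContDiff ℝ (⊤ : ℕ∞) f) :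
    ∃ M : ℝ, 0 ≤ M ∧ ∀ x ∈ S, ∀ y ∈ S,
      |f y - f x| ≤ ‖fderiv ℝ f x‖ * ‖y - x‖ + M * ‖y - x‖ ^ 2 := by
  obtain ⟨R, hR⟩ := hS.subset_closedBall 0
  set K := Metric.closedBall (0 : EE n) R with hK
  have hKc : IsCompact K := isCompact_closedBall _ _
  have hKconv : Convex ℝ K := convex_closedBall _ _
  have hd : ContDiff ℝ 1 (fderiv ℝ f) :=
    hf.fderiv_right (m := 1) (by norm_cast)
  obtain ⟨M, hM⟩ := (hd.locallyLipschitz.locallyLipschitzOn (s := K)).exists_lipschitzOnWith_of_compact hKc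
  refine ⟨M, M.2, fun x hx y hy => ?_⟩
  have hseg : segment ℝ x y ⊆ K := hKconv.segment_subset (hR hx) (hR hy)
  have h1 : ∀ z ∈ segment ℝ x y, ‖fderiv ℝ f z - fderiv ℝ f x‖ ≤ (M : ℝ) * ‖y - x‖ := by
    intro z hz
    have := hM.norm_sub_le (hseg hz) (hR hx)
    refine this.trans ?_
    gcongr
    obtain ⟨a, b, ha, hb, hab, rfl⟩ := hz
    have : a • x + b • y - x = b • (y - x) := by
      have : a = 1 - b := by linarith
      rw [this]; module
    rw [this, norm_smul, Real.norm_of_nonneg hb]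
    nlinarith [norm_nonneg (y - x)]
  have h2 := (convex_segment x y).norm_image_sub_le_of_norm_fderiv_le' (𝕜 := ℝ) (f := f)
    (φ := fderiv ℝ f x) (fun z _ => (hf.differentiable (by simp)) z) h1
    (left_mem_segment ℝ x y) (right_mem_segment ℝ x y)
  have h3 := (fderiv ℝ f x).le_opNorm (y - x)
  rw [Real.norm_eq_abs] at h2 h3
  calc |f y - f x| = |(f y - f x - fderiv ℝ f x (y - x)) + fderiv ℝ f x (y - x)| := by ring_nf
    _ ≤ _ := abs_add_le _ _
    _ ≤ _ := by nlinarith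

lemma exp_lower {t : ℝ} (ht : |t| ≤ 1) : 1 + t + t ^ 2 / 2 - |t| ^ 3 ≤ Real.exp t := by
  have := Real.exp_bound ht (n := 3) (by norm_num)
  simp [Finset.sum_range_succ, Nat.factorial] at this
  have h2 := (abs_le.1 this).1
  have : 0 ≤ |t| ^ 3 := by positivity
  nlinarith

lemma poincare {n : ℕ} {S : Set (EE n)} (hS : Bornology.IsBounded S) (hm : MeasurableSet S)
    (hc : Convex ℝ S) (x0 : EE n) {ρ : ℝ} (hρ : 0 < ρ)
    {f : EE n → ℝ} (hf : ContDiff ℝ (⊤ : ℕ∞) f)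
    (hmean : ∫ x in S, f x * Real.exp (-(ρ / 2) * ‖x - x0‖ ^ 2) = 0) :
    ∫ x in S, f x ^ 2 * Real.exp (-(ρ / 2) * ‖x - x0‖ ^ 2)
      ≤ (1 / ρ) * ∫ x in S, ‖fderiv ℝ f x‖ ^ 2 * Real.exp (-(ρ / 2) * ‖x - x0‖ ^ 2) := by
  set w : EE n → ℝ := fun x => Real.exp (-(ρ / 2) * ‖x - x0‖ ^ 2) with hw
  have hwc : Continuous w := by fun_prop
  have hw0 : ∀ x, 0 < w x := fun x => Real.exp_pos _
  have hfc : Continuous f := hf.continuous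
  have hdc : Continuous (fderiv ℝ f) := hf.continuous_fderiv (by simp)
  obtain ⟨M, hM0, hM⟩ := taylor hS hf
  obtain ⟨B0, hB0⟩ := hS.isCompact_closure.exists_bound_of_continuousOn hfc.continuousOn
  set B := max B0 1 with hB
  have hB1 : 1 ≤ B := le_max_right _ _
  have hfB : ∀ x ∈ S, |f x| ≤ B := fun x hx =>
    (hB0 x (subset_closure hx)).trans (le_max_left _ _)
  set N := ∫ x in S, w x with hN
  set F := ∫ x in S, f x ^ 2 * w x with hF
  set D := ∫ x in S, ‖fderiv ℝ f x‖ ^ 2 * w x with hD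
  have hN0 : 0 ≤ N := integral_nonneg fun x => (hw0 x).le
  have hD0 : 0 ≤ D := integral_nonneg fun x => mul_nonneg (by positivity) (hw0 x).le
  have I : ∀ {u : EE n → ℝ}, Continuous u → IntegrableOn u S := fun hu => integrableOn_of_cont hS hu
  rcases hN0.eq_or_lt with hNz | hNpos
  · -- null set
    have hz : volume S = 0 := by
      by_contra hne
      have : 0 < N := by
        rw [hN, setIntegral_pos_iff_support_of_nonneg_ae (.of_forall fun x => (hw0 x).le) (I hwc)]
        have : Function.support w = univ := by
          ext x; simpa using (hw0 x).ne'
        rw [this, univ_inter]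
        exact pos_iff_ne_zero.2 hne
      linarith
    have hr : (volume : Measure (EE n)).restrict S = 0 := Measure.restrict_eq_zero.2 hz
    simp [hF, hD, hr]
  -- lower bound for exponential integrals
  have low : ∀ e : ℝ, |e| * B ≤ 1 →
      N + e ^ 2 * (F / 2) - |e| ^ 3 * B ^ 3 * N ≤ ∫ x in S, Real.exp (e * f x) * w x := by
    intro e he
    have h1 : ∫ x in S, (1 * w x + e * (f x * w x) + (e ^ 2 / 2) * (f x ^ 2 * w x)
        - |e| ^ 3 * B ^ 3 * w x) = N + e ^ 2 * (F / 2) - |e| ^ 3 * B ^ 3 * N := by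
      rw [integral_sub (I (by fun_prop)) (I (by fun_prop)),
        integral_add (I (by fun_prop)) (I (by fun_prop)),
        integral_add (I (by fun_prop)) (I (by fun_prop)),
        integral_const_mul, integral_const_mul, integral_const_mul, integral_const_mul, hmean]
      ring
    rw [← h1]
    refine setIntegral_mono_on (I (by fun_prop)) (I (by fun_prop)) hm fun x hx => ?_
    have hx1 := hfB x hx
    have hle : |e * f x| ≤ |e| * B := by rw [abs_mul]; gcongr
    have h2 := exp_lower (hle.trans he)
    have h3 : |e * f x| ^ 3 ≤ |e| ^ 3 * B ^ 3 := by rw [← mul_pow]; gcongr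
    have := hw0 x
    nlinarith
  have main : ∀ e : ℝ, 0 < e → e * B ≤ 1 → 4 * e * M < ρ → e ^ 3 * B ^ 3 < 1 →
      (F / 2 - e * B ^ 3 * N - (1 / (ρ - 4 * e * M)) * Real.exp (e * B) * D)
        * (N + e ^ 2 * (F / 2) - e ^ 3 * B ^ 3 * N) + N * (F / 2 - e * B ^ 3 * N) ≤ 0 := by
    intro e he heB heM he3
    set κ := 1 / (ρ - 4 * e * M) with hκ
    have hden : 0 < ρ - 4 * e * M := by linarith
    have hκ0 : 0 < κ := by positivity
    have hpl := real_PL hS hm hc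
      (u := fun x => Real.exp (e * f x - e ^ 2 * κ * ‖fderiv ℝ f x‖ ^ 2) * w x)
      (v := fun x => Real.exp (-e * f x) * w x) (w := w)
      (by fun_prop) (by fun_prop) hwc (fun x => mul_nonneg (Real.exp_pos _).le (hw0 x).le)
      (fun x => mul_nonneg (Real.exp_pos _).le (hw0 x).le) (fun x => (hw0 x).le) ?_
    · have l1 : N + e ^ 2 * (F / 2) - e ^ 3 * B ^ 3 * N - e ^ 2 * κ * Real.exp (e * B) * D
          ≤ ∫ x in S, Real.exp (e * f x - e ^ 2 * κ * ‖fderiv ℝ f x‖ ^ 2) * w x := by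
        have h0 := low e (by rwa [abs_of_pos he])
        rw [abs_of_pos he] at h0
        have h1 : ∫ x in S, (Real.exp (e * f x) * w x
            - (e ^ 2 * κ * Real.exp (e * B)) * (‖fderiv ℝ f x‖ ^ 2 * w x))
            = (∫ x in S, Real.exp (e * f x) * w x) - e ^ 2 * κ * Real.exp (e * B) * D := by
          rw [integral_sub (I (by fun_prop)) (I (by fun_prop)), integral_const_mul]
        refine le_trans (by rw [h1]; linarith) (setIntegral_mono_on (I (by fun_prop)) (I (by fun_prop)) hm
          fun x hx => ?_)
        · have hx1 := (abs_le.1 (hfB x hx)).2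
          rw [sub_eq_add_neg, sub_eq_add_neg, Real.exp_add]
          have a1 : Real.exp (e * f x) ≤ Real.exp (e * B) := by gcongr
          have a2 := Real.add_one_le_exp (-(e ^ 2 * κ * ‖fderiv ℝ f x‖ ^ 2))
          have a3 := Real.exp_pos (e * f x)
          have a4 := hw0 x
          have a5 : 0 ≤ e ^ 2 * κ * ‖fderiv ℝ f x‖ ^ 2 := by positivity
          set q := e ^ 2 * κ * ‖fderiv ℝ f x‖ ^ 2 with hq
          have : (Real.exp (e * f x) - q * Real.exp (e * B)) * w x
              ≤ (Real.exp (e * f x) * Real.exp (-q)) * w x := by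
            gcongr
            nlinarith
          calc _ = (Real.exp (e * f x) - q * Real.exp (e * B)) * w x := by rw [hq]; ring
            _ ≤ _ := this
      have l2 : N + e ^ 2 * (F / 2) - e ^ 3 * B ^ 3 * N ≤ ∫ x in S, Real.exp (-e * f x) * w x := by
        have h0 := low (-e) (by rwa [abs_neg, abs_of_pos he])
        rw [abs_neg, abs_of_pos he, neg_sq] at h0
        exact h0
      have hF0 : 0 ≤ F := integral_nonneg fun x => mul_nonneg (by positivity) (hw0 x).le
      have p2 : 0 ≤ N + e ^ 2 * (F / 2) - e ^ 3 * B ^ 3 * N := by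
        have : e ^ 3 * B ^ 3 * N ≤ 1 * N := by gcongr
        have : 0 ≤ e ^ 2 * (F / 2) := by positivity
        linarith
      have p1 : 0 ≤ ∫ x in S, Real.exp (e * f x - e ^ 2 * κ * ‖fderiv ℝ f x‖ ^ 2) * w x :=
        integral_nonneg fun x => mul_nonneg (Real.exp_pos _).le (hw0 x).le
      have h5 := (mul_le_mul_of_nonneg_right l1 p2).trans (mul_le_mul_of_nonneg_left l2 p1)
      have h6 := h5.trans hpl
      have h7 : e ^ 2 * ((F / 2 - e * B ^ 3 * N - κ * Real.exp (e * B) * D)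
        * (N + e ^ 2 * (F / 2) - e ^ 3 * B ^ 3 * N) + N * (F / 2 - e * B ^ 3 * N)) ≤ 0 := by
        linarith
      exact nonpos_of_mul_nonpos_right h7 (by positivity)
    · intro x hx y hy
      simp only [hw]
      rw [← Real.exp_add, ← Real.exp_add, ← Real.exp_add, ← Real.exp_nat_mul]
      apply Real.exp_le_exp.2
      have hp : ‖(1/2 : ℝ) • (x + y) - x0‖ ^ 2
          = ‖x - x0‖ ^ 2 / 2 + ‖y - x0‖ ^ 2 / 2 - ‖y - x‖ ^ 2 / 4 := by
        have h1 := parallelogram_law_with_norm ℝ (x - x0) (y - x0)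
        have e1 : (1/2 : ℝ) • (x + y) - x0 = (1/2 : ℝ) • ((x - x0) + (y - x0)) := by
          module
        have e2 : (x - x0) - (y - x0) = -(y - x) := by abel
        rw [e2, norm_neg] at h1
        rw [e1, norm_smul, mul_pow]
        norm_num
        nlinarith
      have ht := hM x hx y hy
      have ht2 := (abs_le.1 ht).1
      set G := ‖fderiv ℝ f x‖
      set d := ‖y - x‖
      have hsq : e * G * d ≤ (ρ - 4 * e * M) / 4 * d ^ 2 + e ^ 2 * κ * G ^ 2 := by
        have : (ρ - 4 * e * M) / 4 * d ^ 2 + e ^ 2 * κ * G ^ 2 - e * G * d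
          = κ * ((ρ - 4 * e * M) * d / 2 - e * G) ^ 2 := by
          rw [hκ]; field_simp; ring
        have h2 : 0 ≤ κ * ((ρ - 4 * e * M) * d / 2 - e * G) ^ 2 := by positivity
        linarith
      have h3 : e * (f x - f y) ≤ e * (G * d + M * d ^ 2) := by
        gcongr; linarith
      rw [hp]
      push_cast
      nlinarith
  -- pass to the limit
  have hcont : ContinuousAt (fun e : ℝ =>
      (F / 2 - e * B ^ 3 * N - (1 / (ρ - 4 * e * M)) * Real.exp (e * B) * D)
        * (N + e ^ 2 * (F / 2) - e ^ 3 * B ^ 3 * N) + N * (F / 2 - e * B ^ 3 * N)) 0 := by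
    have : ContinuousAt (fun e : ℝ => 1 / (ρ - 4 * e * M)) 0 := by
      apply ContinuousAt.div (by fun_prop) (by fun_prop)
      simpa using hρ.ne'
    fun_prop
  have hlim := (hcont.tendsto.mono_left (nhdsWithin_le_nhds (s := Ioi 0)))
  have hev : ∀ᶠ e : ℝ in nhdsWithin 0 (Ioi 0), 0 < e ∧ e * B ≤ 1 ∧ 4 * e * M < ρ ∧ e ^ 3 * B ^ 3 < 1 := by
    have c1 : ∀ᶠ e : ℝ in nhds 0, e * B < 1 :=
      (Continuous.tendsto (by fun_prop) 0).eventually_lt_const (by simp)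
    have c2 : ∀ᶠ e : ℝ in nhds 0, 4 * e * M < ρ :=
      (Continuous.tendsto (by fun_prop) 0).eventually_lt_const (by simpa using hρ)
    have c3 : ∀ᶠ e : ℝ in nhds 0, e ^ 3 * B ^ 3 < 1 :=
      (Continuous.tendsto (by fun_prop) 0).eventually_lt_const (by simp)
    filter_upwards [self_mem_nhdsWithin, nhdsWithin_le_nhds c1, nhdsWithin_le_nhds c2,
      nhdsWithin_le_nhds c3] with e h0 h1 h2 h3
    exact ⟨h0, h1.le, h2, h3⟩
  have hfin := le_of_tendsto hlim (hev.mono fun e he => main e he.1 he.2.1 he.2.2.1 he.2.2.2)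
  simp at hfin
  have h8 : N * (F - 1 / ρ * D) ≤ 0 := by
    rw [one_div]; linarith
  have := nonpos_of_mul_nonpos_right h8 hNpos
  linarith

/-- Unweighted version on sets contained in a ball of radius `r`. -/
lemma poincare_ball {n : ℕ} {S : Set (EE n)} (hm : MeasurableSet S)
    (hc : Convex ℝ S) (x0 : EE n) {r : ℝ} (hr : 0 < r) (hSr : S ⊆ Metric.closedBall x0 r)
    {f : EE n → ℝ} (hf : ContDiff ℝ (⊤ : ℕ∞) f)
    (hmean : ∫ x in S, f x * Real.exp (-(2 / r ^ 2 / 2) * ‖x - x0‖ ^ 2) = 0) :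
    ∫ x in S, f x ^ 2 ≤ 2 * r ^ 2 * ∫ x in S, ‖fderiv ℝ f x‖ ^ 2 := by
  have hS : Bornology.IsBounded S := Metric.isBounded_closedBall.subset hSr
  have hfc : Continuous f := hf.continuous
  have hdc : Continuous (fderiv ℝ f) := hf.continuous_fderiv (by simp)
  have I : ∀ {u : EE n → ℝ}, Continuous u → IntegrableOn u S := fun hu => integrableOn_of_cont hS hu
  have h := poincare hS hm hc x0 (ρ := 2 / r ^ 2) (by positivity) hf hmean
  have h1 : Real.exp (-1) * ∫ x in S, f x ^ 2
      ≤ ∫ x in S, f x ^ 2 * Real.exp (-(2 / r ^ 2 / 2) * ‖x - x0‖ ^ 2) := by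
    rw [← integral_const_mul]
    refine setIntegral_mono_on (I (by fun_prop)) (I (by fun_prop)) hm fun x hx => ?_
    rw [mul_comm]
    gcongr
    have hx2 : ‖x - x0‖ ≤ r := by simpa [dist_eq_norm] using hSr hx
    have : ‖x - x0‖ ^ 2 ≤ r ^ 2 := by gcongr
    have h3 : 2 / r ^ 2 / 2 * ‖x - x0‖ ^ 2 ≤ 1 := by
      rw [div_div, mul_comm (r ^ 2), ← div_div, div_self two_ne_zero, one_div, inv_mul_le_iff₀ (by positivity)]
      linarith
    linarith
  have h2 : ∫ x in S, ‖fderiv ℝ f x‖ ^ 2 * Real.exp (-(2 / r ^ 2 / 2) * ‖x - x0‖ ^ 2)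
      ≤ ∫ x in S, ‖fderiv ℝ f x‖ ^ 2 := by
    refine setIntegral_mono_on (I (by fun_prop)) (I (by fun_prop)) hm fun x hx => ?_
    refine mul_le_of_le_one_right (by positivity) ?_
    rw [Real.exp_le_one_iff]
    have : 0 ≤ 2 / r ^ 2 / 2 * ‖x - x0‖ ^ 2 := by positivity
    linarith
  have h3 : Real.exp (-1) * ∫ x in S, f x ^ 2 ≤ r ^ 2 / 2 * ∫ x in S, ‖fderiv ℝ f x‖ ^ 2 := by
    calc _ ≤ _ := h1.trans h
      _ ≤ 1 / (2 / r ^ 2) * ∫ x in S, ‖fderiv ℝ f x‖ ^ 2 := by gcongr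
      _ = _ := by rw [one_div_div]
  have h4 : (1/4 : ℝ) ≤ Real.exp (-1) := by
    rw [Real.exp_neg, one_div]
    apply inv_anti₀ (Real.exp_pos _)
    linarith [Real.exp_one_lt_d9]
  have h5 : 0 ≤ ∫ x in S, f x ^ 2 := integral_nonneg fun x => by positivity
  nlinarith

end Poinc

namespace Upper
open Set Poinc

lemma glue_deriv (u : ℝ) : HasDerivAt expNegInvGlue ((u⁻¹) ^ 2 * expNegInvGlue u) u := by
  have := expNegInvGlue.hasDerivAt_polynomial_eval_inv_mul 1 u
  simpa using this

lemma glue_deriv_le (u : ℝ) : |(u⁻¹) ^ 2 * expNegInvGlue u| ≤ 2 := by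
  rw [abs_of_nonneg (mul_nonneg (by positivity) (expNegInvGlue.nonneg u))]
  rcases le_or_gt u 0 with hu | hu
  · rw [expNegInvGlue.zero_of_nonpos hu]; norm_num
  · have h1 : expNegInvGlue u = Real.exp (-u⁻¹) := by simp [expNegInvGlue, not_le.2 hu]
    rw [h1, Real.exp_neg]
    have hv : 0 ≤ u⁻¹ := by positivity
    have := Real.quadratic_le_exp_of_nonneg hv
    rw [← div_eq_mul_inv, div_le_iff₀ (Real.exp_pos _)]
    nlinarith

noncomputable def bump {n : ℕ} (p : EE n) (s : ℝ) (x : EE n) : ℝ :=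
  expNegInvGlue (n * (1 - ‖x - p‖ ^ 2 / s ^ 2))

lemma bump_contDiff {n : ℕ} (p : EE n) (s : ℝ) : ContDiff ℝ (⊤ : ℕ∞) (bump p s) := by
  unfold bump
  refine expNegInvGlue.contDiff.comp ?_
  refine contDiff_const.mul (contDiff_const.sub (ContDiff.div_const ?_ _))
  exact (contDiff_id.sub contDiff_const).norm_sq ℝ

lemma bump_zero {n : ℕ} {p : EE n} {s : ℝ} (hs : 0 < s) {x : EE n} (hx : s ≤ ‖x - p‖) :
    bump p s x = 0 := by
  apply expNegInvGlue.zero_of_nonpos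
  apply mul_nonpos_of_nonneg_of_nonpos (by positivity)
  rw [sub_nonpos, one_le_div (by positivity)]
  gcongr

lemma bump_self {n : ℕ} (hn : 1 ≤ n) (p : EE n) (s : ℝ) : 0 < bump p s p := by
  apply expNegInvGlue.pos_of_pos
  have : (1 : ℝ) ≤ n := by exact_mod_cast hn
  simp
  linarith

lemma bump_fderiv {n : ℕ} (p : EE n) (s : ℝ) (x : EE n) :
    HasFDerivAt (bump p s) ((((n * (1 - ‖x - p‖ ^ 2 / s ^ 2) : ℝ)⁻¹) ^ 2 * bump p s x)
      • (-((n : ℝ) * (2 / s ^ 2)) • (innerSL ℝ (x - p)))) x := by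
  have h1 : HasFDerivAt (fun x : EE n => ‖x - p‖ ^ 2) (2 • (innerSL ℝ (x - p))) x := by
    have := (hasFDerivAt_id (𝕜 := ℝ) x).sub_const p |>.norm_sq
    simpa using this
  have h2 : HasFDerivAt (fun x : EE n => (n : ℝ) * (1 - ‖x - p‖ ^ 2 / s ^ 2))
      (-((n : ℝ) * (2 / s ^ 2)) • (innerSL ℝ (x - p))) x := by
    have := ((h1.mul_const ((s ^ 2)⁻¹)).const_sub 1).const_mul (n : ℝ)
    simp only [← div_eq_mul_inv] at this
    refine this.congr_fderiv ?_
    module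
  exact (glue_deriv _).comp_hasFDerivAt x h2

lemma bump_fderiv_zero {n : ℕ} {p : EE n} {s : ℝ} (hs : 0 < s) {x : EE n} (hx : s ≤ ‖x - p‖) :
    fderiv ℝ (bump p s) x = 0 := by
  rw [(bump_fderiv p s x).fderiv, bump_zero hs hx]
  simp

lemma bump_fderiv_le {n : ℕ} {p : EE n} {s : ℝ} (hs : 0 < s) (x : EE n) :
    ‖fderiv ℝ (bump p s) x‖ ≤ 4 * n / s := by
  rcases le_total s ‖x - p‖ with hx | hx
  · rw [bump_fderiv_zero hs hx]; simp; positivity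
  · rw [(bump_fderiv p s x).fderiv, norm_smul, norm_smul, innerSL_apply_norm, Real.norm_eq_abs,
      Real.norm_eq_abs, abs_neg,
      abs_of_nonneg (show (0 : ℝ) ≤ n * (2 / s ^ 2) by positivity)]
    have h1 := glue_deriv_le (n * (1 - ‖x - p‖ ^ 2 / s ^ 2))
    calc _ ≤ 2 * (n * (2 / s ^ 2) * s) := by
          gcongr; exact h1
      _ = 4 * n / s := by field_simp; ring

lemma bump_lower {n : ℕ} (hn : 1 ≤ n) {p : EE n} {s : ℝ} (hs : 0 < s) {x : EE n}
    (hx : ‖x - p‖ ≤ (1 - 1 / (2 * n)) * s) : 1 / 4 ≤ bump p s x := by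
  have hn' : (1 : ℝ) ≤ n := by exact_mod_cast hn
  have ht : (0:ℝ) ≤ 1 - 1 / (2 * n) := by
    rw [sub_nonneg, div_le_one (by positivity)]; linarith
  have h1 : ‖x - p‖ ^ 2 / s ^ 2 ≤ (1 - 1 / (2 * n)) ^ 2 := by
    rw [div_le_iff₀ (by positivity), ← mul_pow]; gcongr
  have h2 : (3 / 4 : ℝ) ≤ n * (1 - ‖x - p‖ ^ 2 / s ^ 2) := by
    calc (3 / 4 : ℝ) ≤ n * (1 - (1 - 1 / (2 * n)) ^ 2) := by
          have : (n : ℝ) * (1 - (1 - 1 / (2 * n)) ^ 2) = 1 - 1 / (4 * n) := by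
            field_simp; ring
          rw [this]
          have : 1 / (4 * (n : ℝ)) ≤ 1 / 4 := by
            apply one_div_le_one_div_of_le <;> linarith
          linarith
      _ ≤ _ := by gcongr
  refine le_trans ?_ (expNegInvGlue.monotone h2)
  have h3 : expNegInvGlue (3 / 4) = Real.exp (-(4 / 3)) := by
    simp [expNegInvGlue]
  rw [h3, Real.exp_neg, one_div]
  apply inv_anti₀ (Real.exp_pos _)
  have h4 : Real.exp (4 / 3) ^ 3 ≤ 4 ^ 3 := by
    rw [← Real.exp_nat_mul]
    have : ((3 : ℕ) : ℝ) * (4 / 3) = (4 : ℕ) * 1 := by norm_num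
    rw [this, Real.exp_nat_mul]
    calc Real.exp 1 ^ 4 ≤ 2.7182818286 ^ 4 := by
          gcongr; exact Real.exp_one_lt_d9.le
      _ ≤ _ := by norm_num
  exact le_of_pow_le_pow_left₀ (by norm_num) (by norm_num) h4

lemma vol_compare {n : ℕ} (hn : 1 ≤ n) {Ω : Set (EE n)} (hc : Convex ℝ Ω)
    (hb : Bornology.IsBounded Ω) {p : EE n} (hp : p ∈ Ω) {s : ℝ} :
    volume.real (Ω ∩ Metric.ball p s)
      ≤ 2 * volume.real (Ω ∩ Metric.closedBall p ((1 - 1 / (2 * n)) * s)) := by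
  have hn' : (1 : ℝ) ≤ n := by exact_mod_cast hn
  set t : ℝ := 1 - 1 / (2 * n) with ht
  have ht0 : 0 ≤ t := by
    rw [ht, sub_nonneg, div_le_one (by positivity)]; linarith
  have ht1 : t ≤ 1 := by
    have : 0 ≤ 1 / (2 * (n : ℝ)) := by positivity
    linarith
  have hpow : 1 / 2 ≤ t ^ n := by
    have := one_add_mul_le_pow (a := -(1 / (2 * (n : ℝ)))) (by
      have : 1 / (2 * (n : ℝ)) ≤ 1 := by rw [div_le_one (by positivity)]; linarith
      linarith) n
    have e : 1 + (n : ℝ) * -(1 / (2 * (n : ℝ))) = 1 / 2 := by field_simp; norm_num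
    rw [e] at this
    rwa [ht, sub_eq_add_neg]
  have hsub : AffineMap.homothety p t '' (Ω ∩ Metric.ball p s) ⊆ Ω ∩ Metric.closedBall p (t * s) := by
    rintro _ ⟨x, ⟨hx, hxs⟩, rfl⟩
    have e : AffineMap.homothety p t x = t • (x - p) + p := by
      simp [AffineMap.homothety_apply]
    refine ⟨?_, ?_⟩
    · rw [e]
      have : t • (x - p) + p = (1 - t) • p + t • x := by module
      rw [this]
      exact hc hp hx (by linarith) ht0 (by ring)
    · rw [e, Metric.mem_closedBall, dist_eq_norm, add_sub_cancel_right, norm_smul,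
        Real.norm_of_nonneg ht0]
      rw [Metric.mem_ball, dist_eq_norm] at hxs
      gcongr
  have hfin : volume (Ω ∩ Metric.closedBall p (t * s)) ≠ ⊤ :=
    (hb.subset inter_subset_left).measure_lt_top.ne
  have h1 := measure_mono (μ := volume) hsub
  rw [Measure.addHaar_image_homothety] at h1
  have h2 := ENNReal.toReal_mono hfin h1
  rw [ENNReal.toReal_mul, ENNReal.toReal_ofReal (abs_nonneg _), finrank_euclideanSpace_fin,
    abs_of_nonneg (by positivity)] at h2
  change t ^ n * volume.real (Ω ∩ Metric.ball p s) ≤ volume.real (Ω ∩ Metric.closedBall p (t * s)) at h2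
  have h3 : 0 ≤ volume.real (Ω ∩ Metric.ball p s) := measureReal_nonneg
  nlinarith

lemma bump_rayleigh {n : ℕ} (hn : 1 ≤ n) {Ω : Set (EE n)} (hc : Convex ℝ Ω)
    (hm : MeasurableSet Ω) (hb : Bornology.IsBounded Ω) {p : EE n} (hp : p ∈ Ω)
    {s : ℝ} (hs : 0 < s) :
    ∫ x in Ω, ‖fderiv ℝ (bump p s) x‖ ^ 2 ≤ 512 * n ^ 2 / s ^ 2 * ∫ x in Ω, bump p s x ^ 2 := by
  have hfc : Continuous (bump p s) := (bump_contDiff p s).continuous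
  have hdc : Continuous (fderiv ℝ (bump p s)) := (bump_contDiff p s).continuous_fderiv (by simp)
  have I : ∀ {u : EE n → ℝ}, Continuous u → IntegrableOn u Ω := fun hu => integrableOn_of_cont hb hu
  have hft : volume Ω ≠ ⊤ := hb.measure_lt_top.ne
  set c := 4 * n / s with hcdef
  set t : ℝ := (1 - 1 / (2 * n)) * s
  have h1 : ∫ x in Ω, ‖fderiv ℝ (bump p s) x‖ ^ 2 ≤ c ^ 2 * volume.real (Ω ∩ Metric.ball p s) := by
    have e : c ^ 2 * volume.real (Ω ∩ Metric.ball p s)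
        = ∫ x in Ω, (Metric.ball p s).indicator (fun _ => c ^ 2) x := by
      rw [setIntegral_indicator measurableSet_ball, setIntegral_const, smul_eq_mul, mul_comm]
    rw [e]
    refine setIntegral_mono_on (I (by fun_prop)) ?_ hm fun x hx => ?_
    · exact ((integrableOn_const hft).integrable).indicator measurableSet_ball
    · by_cases hxs : x ∈ Metric.ball p s
      · rw [indicator_of_mem hxs]
        have := bump_fderiv_le (p := p) hs x
        gcongr
      · rw [indicator_of_notMem hxs, bump_fderiv_zero hs (by simpa [dist_eq_norm] using hxs)]
        simp
  have h2 : (1 / 4) ^ 2 * volume.real (Ω ∩ Metric.closedBall p t) ≤ ∫ x in Ω, bump p s x ^ 2 := by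
    have e : (1 / 4) ^ 2 * volume.real (Ω ∩ Metric.closedBall p t)
        = ∫ x in Ω, (Metric.closedBall p t).indicator (fun _ => ((1 : ℝ) / 4) ^ 2) x := by
      rw [setIntegral_indicator measurableSet_closedBall, setIntegral_const, smul_eq_mul, mul_comm]
    rw [e]
    refine setIntegral_mono_on ?_ (I (by fun_prop)) hm fun x hx => ?_
    · exact ((integrableOn_const hft).integrable).indicator measurableSet_closedBall
    · by_cases hxs : x ∈ Metric.closedBall p t
      · rw [indicator_of_mem hxs]
        have := bump_lower hn (p := p) hs (x := x) (by
          rw [Metric.mem_closedBall, dist_eq_norm] at hxs; exact hxs)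
        gcongr
      · rw [indicator_of_notMem hxs]; positivity
  have h3 := vol_compare hn hc hb hp (s := s)
  calc _ ≤ _ := h1
    _ ≤ c ^ 2 * (2 * (16 * ∫ x in Ω, bump p s x ^ 2)) := by
        gcongr
        refine h3.trans ?_
        gcongr
        linarith
    _ = _ := by rw [hcdef]; ring

lemma norm_sum_sq {ι F : Type*} [Fintype ι] [NormedAddCommGroup F] (v : ι → F)
    (h : ∀ i j, i ≠ j → v i = 0 ∨ v j = 0) : ‖∑ i, v i‖ ^ 2 = ∑ i, ‖v i‖ ^ 2 := by
  classical
  by_cases hz : ∀ i, v i = 0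
  · simp [hz]
  · push Not at hz
    obtain ⟨i, hi⟩ := hz
    have h0 : ∀ j, j ≠ i → v j = 0 := fun j hj => (h i j hj.symm).resolve_left hi
    rw [Finset.sum_eq_single i (fun j _ hj => h0 j hj) (by simp),
      Finset.sum_eq_single i (fun j _ hj => by simp [h0 j hj]) (by simp)]

/-- The test space spanned by separated bumps. -/
lemma test_space {n : ℕ} (hn : 1 ≤ n) {Ω : Set (EE n)} (hc : Convex ℝ Ω)
    (hm : MeasurableSet Ω) (hb : Bornology.IsBounded Ω) (k : ℕ) (p : Fin (k + 1) → EE n)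
    (hp : ∀ i, p i ∈ Ω) {r : ℝ} (hr : 0 < r) (hsep : ∀ i j, i ≠ j → r ≤ dist (p i) (p j)) :
    ∃ V : Submodule ℝ (EE n → ℝ), (Module.finrank ℝ V = k + 1 ∧ (∀ f ∈ V, ContDiff ℝ (⊤ : ℕ∞) f) ∧
      ∀ f ∈ V, (∀ x ∈ Ω, f x = 0) → f = 0) ∧
      ∀ f ∈ V, ∫ x in Ω, ‖fderiv ℝ f x‖ ^ 2 ≤ 2048 * n ^ 2 / r ^ 2 * ∫ x in Ω, f x ^ 2 := by
  set s := r / 2 with hs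
  have hs0 : 0 < s := by positivity
  set φ : Fin (k + 1) → EE n → ℝ := fun i => bump (p i) s with hφ
  have hfar : ∀ i j, i ≠ j → ∀ x, s ≤ ‖x - p i‖ ∨ s ≤ ‖x - p j‖ := by
    intro i j hij x
    by_contra hcon
    push Not at hcon
    have h1 := hsep i j hij
    have h2 := dist_triangle_left (p i) (p j) x
    rw [dist_eq_norm x, dist_eq_norm x] at h2
    linarith [hcon.1, hcon.2]
  have hval : ∀ i j, i ≠ j → φ j (p i) = 0 := by
    intro i j hij
    refine bump_zero hs0 ?_
    have := hsep i j hij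
    rw [dist_eq_norm] at this
    linarith
  have hev : ∀ (c : Fin (k + 1) → ℝ) i, (∑ j, c j • φ j) (p i) = c i * φ i (p i) := by
    intro c i
    rw [Finset.sum_apply, Finset.sum_eq_single i]
    · simp
    · intro j _ hj; simp [hval i j hj.symm]
    · simp
  have hself : ∀ i, φ i (p i) ≠ 0 := fun i => (bump_self hn (p i) s).ne'
  have hli : LinearIndependent ℝ φ := by
    rw [Fintype.linearIndependent_iff]
    intro c hc0 i
    have := hev c i
    rw [hc0] at this
    simpa [hself i] using this
  have hsm : ∀ i, ContDiff ℝ (⊤ : ℕ∞) (φ i) := fun i => bump_contDiff _ _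
  have hfc : ∀ i, Continuous (φ i) := fun i => (hsm i).continuous
  have hdc : ∀ i, Continuous (fderiv ℝ (φ i)) := fun i => (hsm i).continuous_fderiv (by simp)
  have I : ∀ {u : EE n → ℝ}, Continuous u → IntegrableOn u Ω := fun hu => integrableOn_of_cont hb hu
  refine ⟨Submodule.span ℝ (range φ), ⟨?_, ?_, ?_⟩, ?_⟩
  · rw [finrank_span_eq_card hli]; simp
  · intro f hf
    obtain ⟨c, rfl⟩ := (Submodule.mem_span_range_iff_exists_fun ℝ).1 hf
    have : (∑ j, c j • φ j) = fun x => ∑ j, c j • φ j x := by ext x; simp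
    rw [this]
    exact ContDiff.sum fun i _ => (hsm i).const_smul (c i)
  · intro f hf h0
    obtain ⟨c, rfl⟩ := (Submodule.mem_span_range_iff_exists_fun ℝ).1 hf
    have : ∀ i, c i = 0 := fun i => by
      have := hev c i
      rw [h0 _ (hp i)] at this
      simpa [hself i] using this
    simp [this]
  · intro f hf
    obtain ⟨c, rfl⟩ := (Submodule.mem_span_range_iff_exists_fun ℝ).1 hf
    have e1 : ∀ x, (∑ j, c j • φ j) x ^ 2 = ∑ j, c j ^ 2 * φ j x ^ 2 := by
      intro x
      have := norm_sum_sq (fun j => c j • φ j x) (fun i j hij => by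
        rcases hfar i j hij x with h | h
        · left; simp [hφ, bump_zero hs0 h]
        · right; simp [hφ, bump_zero hs0 h])
      simpa [mul_pow] using this
    have e2 : ∀ x, ‖fderiv ℝ (∑ j, c j • φ j) x‖ ^ 2 = ∑ j, c j ^ 2 * ‖fderiv ℝ (φ j) x‖ ^ 2 := by
      intro x
      have h1 : fderiv ℝ (∑ j, c j • φ j) x = ∑ j, c j • fderiv ℝ (φ j) x := by
        apply HasFDerivAt.fderiv
        exact HasFDerivAt.sum fun i _ =>
          (((hsm i).differentiable (by simp)) x).hasFDerivAt.const_smul (c i)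
      rw [h1]
      have := norm_sum_sq (fun j => c j • fderiv ℝ (φ j) x) (fun i j hij => by
        rcases hfar i j hij x with h | h
        · left; simp [hφ, bump_fderiv_zero hs0 h]
        · right; simp [hφ, bump_fderiv_zero hs0 h])
      rw [this]
      simp [norm_smul, mul_pow]
    simp_rw [e1, e2]
    rw [integral_finsetSum _ (fun i _ => I (by have := hdc i; fun_prop)),
      integral_finsetSum _ (fun i _ => I (by have := hfc i; fun_prop)), Finset.mul_sum]
    refine Finset.sum_le_sum fun i _ => ?_
    rw [integral_const_mul, integral_const_mul]
    have := bump_rayleigh hn hc hm hb (hp i) hs0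
    have hcst : (512 * (n : ℝ) ^ 2 / s ^ 2) = 2048 * n ^ 2 / r ^ 2 := by
      rw [hs]; field_simp; norm_num
    rw [hcst] at this
    calc _ ≤ c i ^ 2 * (2048 * n ^ 2 / r ^ 2 * ∫ x in Ω, φ i x ^ 2) := by gcongr
      _ = _ := by ring

end Upper

namespace Final
open Set Poinc

lemma sq_int_pos {n : ℕ} {Ω : Set (EE n)} (ho : IsOpen Ω) (hb : Bornology.IsBounded Ω)
    {f : EE n → ℝ} (hf : Continuous f) (hv : (∀ x ∈ Ω, f x = 0) → f = 0) (h0 : f ≠ 0) :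
    0 < ∫ x in Ω, f x ^ 2 := by
  have hnn : 0 ≤ ∫ x in Ω, f x ^ 2 := integral_nonneg fun x => by positivity
  refine lt_of_le_of_ne hnn fun he => h0 (hv ?_)
  have hi : IntegrableOn (fun x => f x ^ 2) Ω := integrableOn_of_cont hb (by fun_prop)
  have h1 := (setIntegral_eq_zero_iff_of_nonneg_ae
    (Filter.Eventually.of_forall fun x => sq_nonneg (f x)) hi).1 he.symm
  have h2 : EqOn (fun x => f x ^ 2) 0 Ω :=
    Measure.eqOn_open_of_ae_eq h1 ho (by fun_prop) (by fun_prop)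
  intro x hx
  have := h2 hx
  simpa using this

lemma quot_nonneg {n : ℕ} (Ω : Set (EE n)) (f : EE n → ℝ) :
    0 ≤ (∫ x in Ω, ‖fderiv ℝ f x‖ ^ 2) / ∫ x in Ω, (f x) ^ 2 :=
  div_nonneg (integral_nonneg fun x => by positivity) (integral_nonneg fun x => by positivity)

lemma neumann_nonneg (n k : ℕ) (Ω : Set (EE n)) : 0 ≤ neumannEigenvalue n k Ω :=
  Real.iInf_nonneg fun _ => Real.iSup_nonneg fun _ => quot_nonneg _ _

lemma neumann_upper {n : ℕ} (hn : 1 ≤ n) {Ω : Set (EE n)} (hc : Convex ℝ Ω)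
    (ho : IsOpen Ω) (hb : Bornology.IsBounded Ω) (k : ℕ) (p : Fin (k + 1) → EE n)
    (hp : ∀ i, p i ∈ Ω) {r : ℝ} (hr : 0 < r) (hsep : ∀ i j, i ≠ j → r ≤ dist (p i) (p j)) :
    neumannEigenvalue n k Ω ≤ 2048 * n ^ 2 / r ^ 2 := by
  obtain ⟨V, hV, hR⟩ := Upper.test_space hn hc ho.measurableSet hb k p hp hr hsep
  have hbd : BddBelow (range fun V : {V : Submodule ℝ (EuclideanSpace ℝ (Fin n) → ℝ) //
      Module.finrank ℝ V = k + 1 ∧ (∀ f ∈ V, ContDiff ℝ (⊤ : ℕ∞) f) ∧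
      ∀ f ∈ V, (∀ x ∈ Ω, f x = 0) → f = 0} =>
    ⨆ f : {f : EuclideanSpace ℝ (Fin n) → ℝ // f ∈ V.1 ∧ f ≠ 0},
      (∫ x in Ω, ‖fderiv ℝ f.1 x‖ ^ 2) / ∫ x in Ω, (f.1 x) ^ 2) :=
    ⟨0, by rintro _ ⟨W, rfl⟩; exact Real.iSup_nonneg fun _ => quot_nonneg _ _⟩
  refine (ciInf_le hbd ⟨V, hV⟩).trans (Real.iSup_le (fun f => ?_) (by positivity))
  exact div_le_of_le_mul₀ (integral_nonneg fun x => by positivity) (by positivity) (hR f.1 f.2.1)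

lemma memLp_two_of_cont {n : ℕ} {Ω : Set (EE n)} (hb : Bornology.IsBounded Ω)
    {F : Type*} [NormedAddCommGroup F] {u : EE n → F} [SecondCountableTopologyEither (EE n) F]
    (hu : Continuous u) : MemLp u 2 (volume.restrict Ω) := by
  rw [memLp_two_iff_integrable_sq_norm hu.aestronglyMeasurable]
  exact integrableOn_of_cont hb (by fun_prop)

lemma norm_toLp_sq {n : ℕ} {Ω : Set (EE n)}
    {F : Type*} [NormedAddCommGroup F] {u : EE n → F} (hu : MemLp u 2 (volume.restrict Ω)) :
    ‖hu.toLp u‖ ^ 2 = ∫ x in Ω, ‖u x‖ ^ 2 := by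
  have h0 : 0 ≤ ∫ x in Ω, ‖u x‖ ^ 2 := integral_nonneg fun x => by positivity
  rw [Lp.norm_toLp, hu.eLpNorm_eq_integral_rpow_norm (by simp) (by simp),
    ENNReal.toReal_ofReal (by positivity)]
  simp only [ENNReal.toReal_ofNat, Real.rpow_ofNat]
  rw [← Real.rpow_natCast, ← Real.rpow_mul h0]
  norm_num

lemma quot_bdd {n k : ℕ} {Ω : Set (EE n)} (ho : IsOpen Ω) (hb : Bornology.IsBounded Ω)
    (V : Submodule ℝ (EE n → ℝ)) (hV1 : Module.finrank ℝ V = k + 1)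
    (hV2 : ∀ f ∈ V, ContDiff ℝ (⊤ : ℕ∞) f) (hV3 : ∀ f ∈ V, (∀ x ∈ Ω, f x = 0) → f = 0) :
    ∃ C, ∀ f ∈ V, ∫ x in Ω, ‖fderiv ℝ f x‖ ^ 2 ≤ C * ∫ x in Ω, f x ^ 2 := by
  have hfd : FiniteDimensional ℝ V := Module.finite_of_finrank_pos (by omega)
  have m1 : ∀ f : V, MemLp f.1 2 (volume.restrict Ω) := fun f =>
    memLp_two_of_cont hb (hV2 f.1 f.2).continuous
  have m2 : ∀ f : V, MemLp (fderiv ℝ f.1) 2 (volume.restrict Ω) := fun f =>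
    memLp_two_of_cont hb ((hV2 f.1 f.2).continuous_fderiv (by simp))
  have hdf : ∀ f : V, Differentiable ℝ f.1 := fun f => (hV2 f.1 f.2).differentiable (by simp)
  let A : V →ₗ[ℝ] Lp ℝ 2 (volume.restrict Ω) :=
    { toFun := fun f => (m1 f).toLp f.1
      map_add' := fun f g => MemLp.toLp_add (m1 f) (m1 g)
      map_smul' := fun c f => MemLp.toLp_const_smul c (m1 f) }
  let B : V →ₗ[ℝ] Lp (EE n →L[ℝ] ℝ) 2 (volume.restrict Ω) :=
    { toFun := fun f => (m2 f).toLp _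
      map_add' := fun f g => by
        rw [← MemLp.toLp_add (m2 f) (m2 g)]
        congr 1
        ext1 x
        exact fderiv_add (hdf f x) (hdf g x)
      map_smul' := fun c f => by
        rw [RingHom.id_apply, ← MemLp.toLp_const_smul c (m2 f)]
        congr 1
        ext1 x
        exact fderiv_const_smul (hdf f x) c }
  let e := (Module.finBasisOfFinrankEq ℝ V hV1).equivFun.symm
  have hinj : Function.Injective A := by
    rw [← LinearMap.ker_eq_bot, LinearMap.ker_eq_bot']
    intro f hf
    by_contra hne
    have hp := sq_int_pos ho hb (hV2 f.1 f.2).continuous (hV3 f.1 f.2)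
      (fun h => hne (Subtype.ext h))
    have h1 : ‖A f‖ ^ 2 = ∫ x in Ω, ‖f.1 x‖ ^ 2 := norm_toLp_sq (m1 f)
    rw [hf] at h1
    simp only [norm_zero, Real.norm_eq_abs, sq_abs] at h1
    rw [← h1] at hp
    norm_num at hp
  obtain ⟨K, _, hK⟩ := LinearMap.exists_antilipschitzWith (A ∘ₗ e.toLinearMap)
    (LinearMap.ker_eq_bot.2 (hinj.comp e.injective))
  let B' := LinearMap.toContinuousLinearMap (B ∘ₗ e.toLinearMap)
  refine ⟨(‖B'‖ * K) ^ 2, fun f hf => ?_⟩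
  set v := e.symm ⟨f, hf⟩
  have hev : e v = ⟨f, hf⟩ := e.apply_symm_apply _
  have h1 : ‖B (e v)‖ ≤ ‖B'‖ * ‖v‖ := B'.le_opNorm v
  have h2 : ‖v‖ ≤ K * ‖A (e v)‖ := by
    have := hK.le_mul_dist v 0
    simpa using this
  have h3 : ‖B (e v)‖ ≤ (‖B'‖ * K) * ‖A (e v)‖ := by
    calc _ ≤ _ := h1
      _ ≤ ‖B'‖ * (K * ‖A (e v)‖) := by gcongr
      _ = _ := by ring
  have h4 : ‖B (e v)‖ ^ 2 ≤ (‖B'‖ * K) ^ 2 * ‖A (e v)‖ ^ 2 := by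
    rw [← mul_pow]; gcongr
  rw [hev] at h4
  have hA : ‖A ⟨f, hf⟩‖ ^ 2 = ∫ x in Ω, ‖f x‖ ^ 2 := norm_toLp_sq (m1 ⟨f, hf⟩)
  have hB : ‖B ⟨f, hf⟩‖ ^ 2 = ∫ x in Ω, ‖fderiv ℝ f x‖ ^ 2 := norm_toLp_sq (m2 ⟨f, hf⟩)
  rw [hA, hB] at h4
  simpa only [Real.norm_eq_abs, sq_abs] using h4

/-- Voronoi cells with ties broken by index. -/
def cell {n m : ℕ} (Ω : Set (EE n)) (p : Fin m → EE n) (i : Fin m) : Set (EE n) :=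
  Ω ∩ ⋂ j, {x | toLex (dist x (p i), i) ≤ toLex (dist x (p j), j)}

lemma half_le {n : ℕ} (a b x : EE n) :
    dist x a ≤ dist x b ↔ 2 * inner ℝ (b - a) x ≤ ‖b‖ ^ 2 - ‖a‖ ^ 2 := by
  rw [dist_eq_norm, dist_eq_norm, ← sq_le_sq₀ (norm_nonneg _) (norm_nonneg _),
    norm_sub_sq_real, norm_sub_sq_real, inner_sub_left, real_inner_comm x a, real_inner_comm x b]
  constructor <;> intro h <;> linarith

lemma half_lt {n : ℕ} (a b x : EE n) :
    dist x a < dist x b ↔ 2 * inner ℝ (b - a) x < ‖b‖ ^ 2 - ‖a‖ ^ 2 := by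
  rw [dist_eq_norm, dist_eq_norm, ← sq_lt_sq₀ (norm_nonneg _) (norm_nonneg _),
    norm_sub_sq_real, norm_sub_sq_real, inner_sub_left, real_inner_comm x a, real_inner_comm x b]
  constructor <;> intro h <;> linarith

lemma half_set {n m : ℕ} (p : Fin m → EE n) (i j : Fin m) :
    {x | toLex (dist x (p i), i) ≤ toLex (dist x (p j), j)} =
      if i ≤ j then {x | dist x (p i) ≤ dist x (p j)} else {x | dist x (p i) < dist x (p j)} := by
  ext x
  rw [mem_ofPred_eq, Prod.Lex.toLex_le_toLex]
  split_ifs with h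
  · simp only [h, and_true, mem_ofPred_eq]; exact le_iff_lt_or_eq.symm
  · simp [h]

lemma cell_convex {n m : ℕ} {Ω : Set (EE n)} (hc : Convex ℝ Ω) (p : Fin m → EE n) (i : Fin m) :
    Convex ℝ (cell Ω p i) := by
  refine hc.inter (convex_iInter fun j => ?_)
  have hl : IsLinearMap ℝ (fun x => 2 * inner ℝ (p j - p i) x) :=
    ⟨fun x y => by rw [inner_add_right]; ring, fun c x => by rw [inner_smul_right]; simp; ring⟩
  rw [half_set]
  split_ifs
  · simp_rw [half_le]; exact convex_halfSpace_le hl _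
  · simp_rw [half_lt]; exact convex_halfSpace_lt hl _

lemma cell_measurable {n m : ℕ} {Ω : Set (EE n)} (hm : MeasurableSet Ω) (p : Fin m → EE n)
    (i : Fin m) : MeasurableSet (cell Ω p i) := by
  refine hm.inter (MeasurableSet.iInter fun j => ?_)
  rw [half_set]
  split_ifs
  · exact (isClosed_le (by fun_prop) (by fun_prop)).measurableSet
  · exact (isOpen_lt (by fun_prop) (by fun_prop)).measurableSet

lemma cell_disj {n m : ℕ} (Ω : Set (EE n)) (p : Fin m → EE n) :
    Pairwise (Function.onFun Disjoint (cell Ω p)) := by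
  intro i j hij
  rw [Function.onFun, Set.disjoint_left]
  intro x hi hj
  have h1 := mem_iInter.1 hi.2 j
  have h2 := mem_iInter.1 hj.2 i
  rw [mem_ofPred_eq] at h1 h2
  have := congrArg (fun q : Lex (ℝ × Fin m) => (ofLex q).2) (le_antisymm h1 h2)
  exact hij this

lemma cell_union {n m : ℕ} (Ω : Set (EE n)) (p : Fin m → EE n) {r : ℝ}
    (hcov : ∀ x ∈ Ω, ∃ i, dist x (p i) ≤ r) : ⋃ i, cell Ω p i = Ω := by
  apply subset_antisymm (iUnion_subset fun i => inter_subset_left)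
  intro x hx
  obtain ⟨i0, _⟩ := hcov x hx
  have : Nonempty (Fin m) := ⟨i0⟩
  obtain ⟨i, hi⟩ := Finite.exists_min (fun i => toLex (dist x (p i), i))
  exact mem_iUnion.2 ⟨i, hx, mem_iInter.2 hi⟩

lemma cell_ball {n m : ℕ} (Ω : Set (EE n)) (p : Fin m → EE n) {r : ℝ}
    (hcov : ∀ x ∈ Ω, ∃ i, dist x (p i) ≤ r) (i : Fin m) :
    cell Ω p i ⊆ Metric.closedBall (p i) r := by
  rintro x ⟨hx, hi⟩
  obtain ⟨j, hj⟩ := hcov x hx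
  have h1 := mem_iInter.1 hi j
  rw [mem_ofPred_eq, Prod.Lex.toLex_le_toLex] at h1
  rw [Metric.mem_closedBall]
  rcases h1 with h1 | h1
  · exact h1.le.trans hj
  · exact h1.1.le.trans hj

lemma exists_good {n k m : ℕ} {Ω : Set (EE n)} (hc : Convex ℝ Ω) (ho : IsOpen Ω)
    (hb : Bornology.IsBounded Ω) (hmk : m ≤ k) (p : Fin m → EE n) {r : ℝ} (hr : 0 < r)
    (hcov : ∀ x ∈ Ω, ∃ i, dist x (p i) ≤ r)
    (V : Submodule ℝ (EE n → ℝ)) (hV1 : Module.finrank ℝ V = k + 1)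
    (hV2 : ∀ f ∈ V, ContDiff ℝ (⊤ : ℕ∞) f) :
    ∃ f ∈ V, f ≠ 0 ∧ ∫ x in Ω, f x ^ 2 ≤ 2 * r ^ 2 * ∫ x in Ω, ‖fderiv ℝ f x‖ ^ 2 := by
  have hfd : FiniteDimensional ℝ V := Module.finite_of_finrank_pos (by omega)
  have hsub : ∀ i, cell Ω p i ⊆ Ω := fun i => inter_subset_left
  have hi : ∀ (f : V) (i : Fin m), IntegrableOn
      (fun x => f.1 x * Real.exp (-(2 / r ^ 2 / 2) * ‖x - p i‖ ^ 2)) (cell Ω p i) := fun f i =>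
    integrableOn_of_cont (hb.subset (hsub i)) (by have := (hV2 f.1 f.2).continuous; fun_prop)
  let T : V →ₗ[ℝ] (Fin m → ℝ) :=
    { toFun := fun f i => ∫ x in cell Ω p i, f.1 x * Real.exp (-(2 / r ^ 2 / 2) * ‖x - p i‖ ^ 2)
      map_add' := fun f g => by
        ext i
        rw [Pi.add_apply, ← integral_add (hi f i) (hi g i)]
        congr 1; ext x; simp [add_mul]
      map_smul' := fun c f => by
        ext i
        rw [Pi.smul_apply, smul_eq_mul, RingHom.id_apply, ← integral_const_mul]
        congr 1; ext x; simp [mul_assoc] }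
  have hker : LinearMap.ker T ≠ ⊥ := T.ker_ne_bot_of_finrank_lt (by simp [hV1]; omega)
  obtain ⟨f, hf, hf0⟩ := (Submodule.ne_bot_iff _).1 hker
  have hT : ∀ i, ∫ x in cell Ω p i, f.1 x * Real.exp (-(2 / r ^ 2 / 2) * ‖x - p i‖ ^ 2) = 0 :=
    fun i => congrFun (LinearMap.mem_ker.1 hf) i
  have hs := hV2 f.1 f.2
  have hfc := hs.continuous
  have hdc : Continuous (fderiv ℝ f.1) := hs.continuous_fderiv (by simp)
  refine ⟨f.1, f.2, fun h => hf0 (Subtype.ext h), ?_⟩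
  have key : ∀ {u : EE n → ℝ}, Continuous u → ∫ x in Ω, u x = ∑ i, ∫ x in cell Ω p i, u x := by
    intro u hu
    rw [← integral_iUnion_fintype (cell_measurable ho.measurableSet p) (cell_disj Ω p)
      (fun i => integrableOn_of_cont (hb.subset (hsub i)) hu), cell_union Ω p hcov]
  rw [key (by fun_prop), key (by fun_prop), Finset.mul_sum]
  exact Finset.sum_le_sum fun i _ => poincare_ball (cell_measurable ho.measurableSet p i)
    (cell_convex hc p i) (p i) hr (cell_ball Ω p hcov i) hs (hT i)

lemma exists_line {n : ℕ} (hn : 1 ≤ n) {Ω : Set (EE n)} (ho : IsOpen Ω) (hne : Ω.Nonempty) (k : ℕ) :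
    ∃ (p : Fin (k + 1) → EE n) (r : ℝ), 0 < r ∧ (∀ i, p i ∈ Ω) ∧
      ∀ i j, i ≠ j → r ≤ dist (p i) (p j) := by
  obtain ⟨x0, hx0⟩ := hne
  obtain ⟨ε, hε, hball⟩ := Metric.isOpen_iff.1 ho x0 hx0
  set δ := ε / (k + 1) with hδ
  have hδ0 : 0 < δ := by positivity
  set v : EE n := EuclideanSpace.single ⟨0, hn⟩ (1 : ℝ) with hv
  have hv1 : ‖v‖ = 1 := by simp [hv]
  refine ⟨fun i => x0 + (((i : ℕ) : ℝ) * δ) • v, δ, hδ0, fun i => hball ?_, fun i j hij => ?_⟩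
  · rw [Metric.mem_ball, dist_eq_norm, add_sub_cancel_left, norm_smul, hv1, mul_one,
      Real.norm_of_nonneg (by positivity), hδ]
    have : ((i : ℕ) : ℝ) < k + 1 := by exact_mod_cast i.2
    rw [mul_div_assoc', div_lt_iff₀ (by positivity)]
    nlinarith
  · rw [dist_add_left, dist_eq_norm, ← sub_smul, norm_smul, hv1, mul_one, ← sub_mul, norm_mul,
      Real.norm_of_nonneg hδ0.le]
    have h1 : (1 : ℝ) ≤ ‖((i : ℕ) : ℝ) - ((j : ℕ) : ℝ)‖ := by
      have h2 : (1 : ℤ) ≤ |((i : ℕ) : ℤ) - ((j : ℕ) : ℤ)| := by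
        have : (i : ℕ) ≠ j := fun h => hij (Fin.ext h)
        apply Int.one_le_abs
        omega
      rw [Real.norm_eq_abs]
      exact_mod_cast h2
    nlinarith

lemma neumann_lower {n k m : ℕ} (hn : 1 ≤ n) {Ω : Set (EE n)} (hc : Convex ℝ Ω) (ho : IsOpen Ω)
    (hb : Bornology.IsBounded Ω) (hne : Ω.Nonempty) (hmk : m ≤ k) (p : Fin m → EE n) {r : ℝ}
    (hr : 0 < r) (hcov : ∀ x ∈ Ω, ∃ i, dist x (p i) ≤ r) :
    1 / (2 * r ^ 2) ≤ neumannEigenvalue n k Ω := by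
  obtain ⟨q, δ, hδ, hq, hsep⟩ := exists_line hn ho hne k
  obtain ⟨W, hW, -⟩ := Upper.test_space hn hc ho.measurableSet hb k q hq hδ hsep
  have : Nonempty {V : Submodule ℝ (EuclideanSpace ℝ (Fin n) → ℝ) //
      Module.finrank ℝ V = k + 1 ∧ (∀ f ∈ V, ContDiff ℝ (⊤ : ℕ∞) f) ∧
      ∀ f ∈ V, (∀ x ∈ Ω, f x = 0) → f = 0} := ⟨⟨W, hW⟩⟩
  refine le_ciInf fun V => ?_
  obtain ⟨V, hV1, hV2, hV3⟩ := V
  obtain ⟨C, hC⟩ := quot_bdd ho hb V hV1 hV2 hV3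
  obtain ⟨f, hf, hf0, hle⟩ := exists_good hc ho hb hmk p hr hcov V hV1 hV2
  have hpos : ∀ f ∈ V, f ≠ 0 → 0 < ∫ x in Ω, f x ^ 2 := fun f hf hf0 =>
    sq_int_pos ho hb (hV2 f hf).continuous (hV3 f hf) hf0
  have hbdd : BddAbove (range fun f : {f : EuclideanSpace ℝ (Fin n) → ℝ // f ∈ V ∧ f ≠ 0} =>
      (∫ x in Ω, ‖fderiv ℝ f.1 x‖ ^ 2) / ∫ x in Ω, (f.1 x) ^ 2) := by
    refine ⟨C, ?_⟩
    rintro _ ⟨g, rfl⟩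
    exact (div_le_iff₀ (hpos g.1 g.2.1 g.2.2)).2 (hC g.1 g.2.1)
  refine le_trans ?_ (le_ciSup hbdd ⟨f, hf, hf0⟩)
  have := hpos f hf hf0
  rw [div_le_div_iff₀ (by positivity) this]
  linarith

lemma dichotomy {n : ℕ} (Ω : Set (EE n)) (r : ℝ) (k : ℕ) :
    (∃ p : Fin k → EE n, (∀ i, p i ∈ Ω) ∧ ∀ i j, i ≠ j → r ≤ dist (p i) (p j)) ∨
    ∃ m < k, ∃ p : Fin m → EE n, ∀ x ∈ Ω, ∃ i, dist x (p i) ≤ r := by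
  induction k with
  | zero => left; exact ⟨Fin.elim0, fun i => i.elim0, fun i => i.elim0⟩
  | succ k ih =>
    rcases ih with ⟨p, hp, hsep⟩ | ⟨m, hm, p, hp⟩
    · by_cases h : ∀ x ∈ Ω, ∃ i, dist x (p i) ≤ r
      · exact Or.inr ⟨k, by omega, p, h⟩
      · push Not at h
        obtain ⟨x, hx, hfar⟩ := h
        left
        refine ⟨Fin.cons x p, fun i => ?_, fun i j hij => ?_⟩
        · refine Fin.cases ?_ (fun i => ?_) i
          · simpa using hx
          · simpa using hp i
        · induction i using Fin.cases with
          | zero =>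
            induction j using Fin.cases with
            | zero => exact absurd rfl hij
            | succ j => simpa using (hfar j).le
          | succ i =>
            induction j using Fin.cases with
            | zero => simpa [dist_comm] using (hfar i).le
            | succ j => simpa using hsep i j (fun h => hij (by rw [h]))
    · exact Or.inr ⟨m, by omega, p, hp⟩

lemma final {n : ℕ} (hn : 1 ≤ n) {Ω Ω' : Set (EE n)} (ho : IsOpen Ω) (hc : Convex ℝ Ω)
    (hb : Bornology.IsBounded Ω) (hne : Ω.Nonempty) (ho' : IsOpen Ω') (hc' : Convex ℝ Ω')
    (hb' : Bornology.IsBounded Ω') (hsub : Ω ⊆ Ω') (k : ℕ) :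
    neumannEigenvalue n k Ω' ≤ 92 ^ 2 * (n : ℝ) ^ 2 * neumannEigenvalue n k Ω := by
  have hn' : (0 : ℝ) < n := by exact_mod_cast hn
  set a := neumannEigenvalue n k Ω with ha
  set b := neumannEigenvalue n k Ω' with hb2
  have ha0 : 0 ≤ a := neumann_nonneg _ _ _
  by_contra hcon
  push Not at hcon
  have key : ∀ t : ℝ, 0 < t → b ≤ 2048 * n ^ 2 * t ∨ t ≤ 2 * a := by
    intro t ht
    have hr : 0 < Real.sqrt (1 / t) := Real.sqrt_pos.2 (by positivity)
    have hr2 : Real.sqrt (1 / t) ^ 2 = 1 / t := Real.sq_sqrt (by positivity)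
    rcases dichotomy Ω (Real.sqrt (1 / t)) (k + 1) with ⟨p, hp, hsep⟩ | ⟨m, hm, p, hp⟩
    · left
      have := neumann_upper hn hc' ho' hb' k p (fun i => hsub (hp i)) hr hsep
      rw [hr2] at this
      simpa using this
    · right
      have := neumann_lower hn hc ho hb hne (by omega : m ≤ k) p hr hp
      rw [hr2] at this
      have e : 1 / (2 * (1 / t)) = t / 2 := by field_simp
      rw [e] at this
      linarith
  have hn2 : (0 : ℝ) < n ^ 2 := by positivity
  have hlt : 2 * a < b / (2048 * n ^ 2) := by
    rw [lt_div_iff₀ (by positivity)]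
    have : 0 ≤ (n : ℝ) ^ 2 * a := by positivity
    nlinarith
  obtain ⟨t, ht1, ht2⟩ := exists_between hlt
  rcases key t (by linarith) with h | h
  · rw [lt_div_iff₀ (by positivity)] at ht2
    linarith
  · linarith

end Final

/-- Domain monotonicity for Neumann eigenvalues of convex domains: there is a universal
constant `c > 0` (one may take `c = 92²`) such that for any `n ≥ 1` and any bounded
convex domains `Ω ⊆ Ω'` in `ℝⁿ`, `μ_k(Ω') ≤ c · n² · μ_k(Ω)` for all `k`. -/
theorem domain_monotonicity :
    ∃ c : ℝ, 0 < c ∧ c = 92 ^ 2 ∧ ∀ n : ℕ, 1 ≤ n →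
      ∀ Ω Ω' : Set (EuclideanSpace ℝ (Fin n)),
        IsOpen Ω → Convex ℝ Ω → Bornology.IsBounded Ω → Ω.Nonempty →
        IsOpen Ω' → Convex ℝ Ω' → Bornology.IsBounded Ω' → Ω'.Nonempty →
        Ω ⊆ Ω' →
        ∀ k : ℕ, neumannEigenvalue n k Ω' ≤ c * (n : ℝ) ^ 2 * neumannEigenvalue n k Ω := by
  refine ⟨92 ^ 2, by norm_num, rfl, ?_⟩
  intro n hn Ω Ω' ho hc hb hne ho' hc' hb' _ hsub k
  exact Final.final hn ho hc hb hne ho' hc' hb' hsub k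
end
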